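/- arXiv:2211.02472 — 3 statements merged into one kernel-verified Lean document; each statement's English description precedes it below -/
import Mathlib

section
/- Suppose a ≥ 1. Then there exists a function ε(τ), depending only on τ (and on a and L), with ε(τ) → 0 as τ → 0+, such that for every τ ∈ (0,1) and every x ∈ ℝ, E(1−κ|x,τ) ≤ ( τ² e^{x²/4} + K ∫_1^∞ [tτ²/(1+tτ²)] (1+tτ²)^{−1/2} t^{−a−1} L(t) exp((x²/2)·tτ²/(1+tτ²)) dt ) · (1 + ε(τ)). -/
open MeasureTheory ProbabilityTheory Real Filter Set

noncomputable section

namespace PaperGL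

/-- Posterior density kernel of the shrinkage coefficient `κ` given `(x, τ)`:
`π(κ | x, τ) ∝ κ^(a-1/2) (1-κ)^(-a-1) L(τ⁻²(κ⁻¹-1)) exp((1-κ)x²/2)` on `(0,1)`. -/
def kdens (a : ℝ) (L : ℝ → ℝ) (x τ κ : ℝ) : ℝ :=
  κ ^ (a - 1/2) * (1 - κ) ^ (-a - 1) * L ((1/τ^2) * (1/κ - 1)) * Real.exp ((1 - κ) * x^2 / 2)

/-- Posterior expectation of `g(κ)` given `(x, τ)`. -/
def kExp (a : ℝ) (L : ℝ → ℝ) (x τ : ℝ) (g : ℝ → ℝ) : ℝ :=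
  (∫ κ in Set.Ioo (0:ℝ) 1, g κ * kdens a L x τ κ) /
    (∫ κ in Set.Ioo (0:ℝ) 1, kdens a L x τ κ)

/-- `E(1−κ | x, τ)`. -/
def E1mK (a : ℝ) (L : ℝ → ℝ) (x τ : ℝ) : ℝ := kExp a L x τ (fun κ => 1 - κ)

/-- Posterior mean `T_τ(x) = x · E(1−κ | x, τ)`. -/
def postMean (a : ℝ) (L : ℝ → ℝ) (τ x : ℝ) : ℝ := x * E1mK a L x τ

/-- Posterior variance `Var(θ | x, τ)` of the mixture over `κ` of `N((1−κ)x, 1−κ)`. -/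
def postVar (a : ℝ) (L : ℝ → ℝ) (x τ : ℝ) : ℝ :=
  E1mK a L x τ + x^2 * (kExp a L x τ (fun κ => (1 - κ)^2) - (E1mK a L x τ)^2)

/-- `E(1−κ | x, τ)` in the `t = τ⁻²(κ⁻¹−1)` parametrisation. -/
def E1mKt (a : ℝ) (L : ℝ → ℝ) (x τ : ℝ) : ℝ :=
  (τ^2 * ∫ t in Set.Ioi (0:ℝ),
      (1 + t*τ^2) ^ (-(3:ℝ)/2) * t ^ (-a) * L t * Real.exp ((x^2/2) * (t*τ^2/(1+t*τ^2)))) /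
  (∫ t in Set.Ioi (0:ℝ),
      (1 + t*τ^2) ^ (-(1:ℝ)/2) * t ^ (-a-1) * L t * Real.exp ((x^2/2) * (t*τ^2/(1+t*τ^2))))

/-- The empirical Bayes estimate `τ̂` of the global shrinkage parameter. -/
def tauHat (c1 c2 : ℝ) (n : ℕ) (x : Fin n → ℝ) : ℝ :=
  max (1/(n:ℝ)) ((1/(c2*n)) * ∑ i, if Real.sqrt (c1 * Real.log n) < |x i| then (1:ℝ) else 0)

/-- Nearly black vectors: `θ ∈ ℓ₀[q]`. -/
def sparse (n q : ℕ) (θ : Fin n → ℝ) : Prop := Nat.card {i : Fin n // θ i ≠ 0} ≤ q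

/-- The sampling distribution `N_n(θ₀, I_n)`. -/
def Pmeas (n : ℕ) (θ0 : Fin n → ℝ) : Measure (Fin n → ℝ) :=
  Measure.pi fun i => gaussianReal (θ0 i) 1

/-- `q_n ∝ n^β` (two-sided proportionality). -/
def propTo (q : ℕ → ℕ) (β : ℝ) : Prop :=
  ∃ k1 k2 : ℝ, 0 < k1 ∧ 0 < k2 ∧
    ∀ᶠ n : ℕ in atTop, k1 * (n:ℝ)^β ≤ (q n : ℝ) ∧ (q n : ℝ) ≤ k2 * (n:ℝ)^β

/-- `p_n ∝ n^(-e)` for a real sequence. -/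
def propToR (p : ℕ → ℝ) (β : ℝ) : Prop :=
  ∃ k1 k2 : ℝ, 0 < k1 ∧ 0 < k2 ∧
    ∀ᶠ n : ℕ in atTop, k1 * (n:ℝ)^β ≤ p n ∧ p n ≤ k2 * (n:ℝ)^β

/-- Assumptions (A1) and (A2) on the slowly varying function `L`, together with
positivity, measurability. -/
def AssumpL (L : ℝ → ℝ) (Mb c0 t0 : ℝ) : Prop :=
  Measurable L ∧ (∀ t, 0 < t → 0 < L t) ∧ (∀ t, 0 < t → L t ≤ Mb) ∧
    0 < c0 ∧ 0 < t0 ∧ ∀ t, t0 ≤ t → c0 ≤ L t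

/-- Integrability of `t^(−a−1) L t` on `(0,∞)` with positive integral, and `K` its inverse. -/
def Kcond (a : ℝ) (L : ℝ → ℝ) (K : ℝ) : Prop :=
  MeasureTheory.IntegrableOn (fun t => t ^ (-a-1) * L t) (Set.Ioi (0:ℝ)) ∧
    0 < ∫ t in Set.Ioi (0:ℝ), t ^ (-a-1) * L t ∧
    K = (∫ t in Set.Ioi (0:ℝ), t ^ (-a-1) * L t)⁻¹

/-- The κ-posterior as a probability measure on `(0,1)`. -/
def kPostMeasure (a : ℝ) (L : ℝ → ℝ) (x τ : ℝ) : Measure ℝ :=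
  (∫⁻ κ in Set.Ioo (0:ℝ) 1, ENNReal.ofReal (kdens a L x τ κ))⁻¹ •
    ((volume.restrict (Set.Ioo (0:ℝ) 1)).withDensity fun κ => ENNReal.ofReal (kdens a L x τ κ))

/-- The posterior distribution of `θ` given `(x, τ)`: mixture over `κ` of `N((1−κ)x, 1−κ)`. -/
def thetaPost (a : ℝ) (L : ℝ → ℝ) (x τ : ℝ) : Measure ℝ :=
  (kPostMeasure a L x τ).bind fun κ => gaussianReal ((1-κ)*x) (Real.toNNReal (1-κ))

/-- `Π_τ(· | X)`: the posterior of the vector `θ` given `(X, τ)`. -/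
def PiTau (a : ℝ) (L : ℝ → ℝ) (n : ℕ) (X : Fin n → ℝ) (τ : ℝ) : Measure (Fin n → ℝ) :=
  Measure.pi fun i => thetaPost a L (X i) τ

/-- Marginal density `m(x, τ)` of one observation given `τ` (mixing over `l = λ²`). -/
def marg (a K : ℝ) (L : ℝ → ℝ) (x τ : ℝ) : ℝ :=
  ∫ l in Set.Ioi (0:ℝ), K * l ^ (-a-1) * L l *
    ((Real.sqrt (2 * Real.pi * (1 + l * τ^2)))⁻¹ * Real.exp (-(x^2) / (2 * (1 + l * τ^2))))

/-- Posterior density of `τ` given `X`, for a prior `π2` supported on `[lo, hi]`. -/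
def tauWeight (a K : ℝ) (L : ℝ → ℝ) (π2 : ℝ → ℝ) (lo hi : ℝ) (n : ℕ)
    (X : Fin n → ℝ) (τ : ℝ) : ℝ :=
  (π2 τ * ∏ i, marg a K L (X i) τ) /
    ∫ s in Set.Icc lo hi, π2 s * ∏ i, marg a K L (X i) s

/-- Full Bayes posterior mean `θ̂_i = ∫ T_τ(X_i) π_{2n}(τ|X) dτ`. -/
def fbMean (a K : ℝ) (L : ℝ → ℝ) (π2 : ℝ → ℝ) (n : ℕ) (X : Fin n → ℝ) (i : Fin n) : ℝ :=
  ∫ τ in Set.Icc ((n:ℝ)⁻¹) 1, postMean a L τ (X i) * tauWeight a K L π2 ((n:ℝ)⁻¹) 1 n X τ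

/-- Full Bayes posterior variance `Var(θ_i | X)`. -/
def fbVar (a K : ℝ) (L : ℝ → ℝ) (π2 : ℝ → ℝ) (n : ℕ) (X : Fin n → ℝ) (i : Fin n) : ℝ :=
  (∫ τ in Set.Icc ((n:ℝ)⁻¹) 1,
      (postVar a L (X i) τ + (postMean a L τ (X i))^2) * tauWeight a K L π2 ((n:ℝ)⁻¹) 1 n X τ)
    - (fbMean a K L π2 n X i)^2

/-- The posterior distribution of `τ` given `X`, as a measure on `[lo, hi]`. -/
def tauPostMeasure (a K : ℝ) (L : ℝ → ℝ) (π2 : ℝ → ℝ) (lo hi : ℝ) (n : ℕ)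
    (X : Fin n → ℝ) : Measure ℝ :=
  (∫⁻ τ in Set.Icc lo hi, ENNReal.ofReal (π2 τ * ∏ i, marg a K L (X i) τ))⁻¹ •
    ((volume.restrict (Set.Icc lo hi)).withDensity
      fun τ => ENNReal.ofReal (π2 τ * ∏ i, marg a K L (X i) τ))

/-- The full Bayes posterior `Π(· | X)` of `θ` given `X`. -/
def PiFull (a K : ℝ) (L : ℝ → ℝ) (π2 : ℝ → ℝ) (n : ℕ) (X : Fin n → ℝ) :
    Measure (Fin n → ℝ) :=
  (tauPostMeasure a K L π2 ((n:ℝ)⁻¹) 1 n X).bind fun τ => PiTau a L n X τ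

/-- Condition (C1): `π_{2n}` is a density supported on `[1/n, 1]`. -/
def CondC1 (π2 : ℕ → ℝ → ℝ) : Prop :=
  (∀ (n : ℕ) (τ : ℝ), 0 ≤ π2 n τ) ∧ (∀ (n : ℕ) (τ : ℝ), τ ∉ Set.Icc ((n:ℝ)⁻¹) 1 → π2 n τ = 0) ∧
    ∀ n : ℕ, 1 ≤ n → ∫ τ in Set.Icc ((n:ℝ)⁻¹) 1, π2 n τ = 1

/-- `t_n = C_u π^{3/2} (q_n/n) √(log(n/q_n))`. -/
def tseq (Cu : ℝ) (q : ℕ → ℕ) (n : ℕ) : ℝ :=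
  Cu * Real.pi ^ ((3:ℝ)/2) * ((q n : ℝ)/n) * Real.sqrt (Real.log ((n:ℝ)/(q n)))

/-- Condition (C2). -/
def CondC2 (π2 : ℕ → ℝ → ℝ) (q : ℕ → ℕ) : Prop :=
  ∃ Cu c M1 K' : ℝ, 0 < Cu ∧ c ≤ Cu/2 ∧ 1 ≤ M1 ∧ 0 < K' ∧
    ∀ᶠ n : ℕ in atTop,
      K' * Real.exp (-c * q n) ≤
        ((q n : ℝ)/n)^M1 * ∫ τ in Set.Icc (tseq Cu q n / 2) (tseq Cu q n), π2 n τ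

/-- Full Bayes posterior shrinkage weight `E(1−κ_i | X)`. -/
def fbShrink (a K : ℝ) (L : ℝ → ℝ) (π2 : ℝ → ℝ) (lo hi : ℝ) (n : ℕ)
    (X : Fin n → ℝ) (i : Fin n) : ℝ :=
  ∫ τ in Set.Icc lo hi, E1mK a L (X i) τ * tauWeight a K L π2 lo hi n X τ

/-- Marginal two-groups distribution of one observation:
`(1−p) N(0,1) + p N(0, 1+ψ²)` with `u = ψ²`. -/
def mixM (p u : ℝ) : Measure ℝ :=
  ENNReal.ofReal (1 - p) • gaussianReal 0 1 +
    ENNReal.ofReal p • gaussianReal 0 (Real.toNNReal (1 + u))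

/-- Joint law of `X` given `ν_i = 0`. -/
def nullMeas (n : ℕ) (i : Fin n) (p u : ℝ) : Measure (Fin n → ℝ) :=
  Measure.pi fun j => if j = i then gaussianReal 0 1 else mixM p u

/-- Joint law of `X` given `ν_i = 1`. -/
def altMeas (n : ℕ) (i : Fin n) (p u : ℝ) : Measure (Fin n → ℝ) :=
  Measure.pi fun j => if j = i then gaussianReal 0 (Real.toNNReal (1 + u)) else mixM p u

/-- Type I error `t^{FB}_{1i}` of the full Bayes rule. -/
def t1FB (a K : ℝ) (L : ℝ → ℝ) (π2 : ℕ → ℝ → ℝ) (α : ℕ → ℝ) (p u : ℕ → ℝ)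
    (n : ℕ) (i : Fin n) : ℝ :=
  ((nullMeas n i (p n) (u n))
    {x | 1/2 < fbShrink a K L (π2 n) ((n:ℝ)⁻¹) (α n) n x i}).toReal

/-- Type II error `t^{FB}_{2i}` of the full Bayes rule. -/
def t2FB (a K : ℝ) (L : ℝ → ℝ) (π2 : ℕ → ℝ → ℝ) (α : ℕ → ℝ) (p u : ℕ → ℝ)
    (n : ℕ) (i : Fin n) : ℝ :=
  ((altMeas n i (p n) (u n))
    {x | fbShrink a K L (π2 n) ((n:ℝ)⁻¹) (α n) n x i ≤ 1/2}).toReal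

/-- Bayes risk `R^{FB}_{OG}` of the full Bayes rule. -/
def RFB (a K : ℝ) (L : ℝ → ℝ) (π2 : ℕ → ℝ → ℝ) (α : ℕ → ℝ) (p u : ℕ → ℝ) (n : ℕ) : ℝ :=
  ∑ i : Fin n, ((1 - p n) * t1FB a K L π2 α p u n i + p n * t2FB a K L π2 α p u n i)

/-- Condition (C3): `π_{2n}` is a density supported on `[1/n, α_n]`,
with `α_n → 0` and `n α_n → ∞`. -/
def CondC3 (π2 : ℕ → ℝ → ℝ) (α : ℕ → ℝ) : Prop :=
  (∀ (n : ℕ) (τ : ℝ), 0 ≤ π2 n τ) ∧ (∀ (n : ℕ) (τ : ℝ), τ ∉ Set.Icc ((n:ℝ)⁻¹) (α n) → π2 n τ = 0) ∧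
    (∀ n : ℕ, 1 ≤ n → ∫ τ in Set.Icc ((n:ℝ)⁻¹) (α n), π2 n τ = 1) ∧
    Tendsto α atTop (nhds 0) ∧ Tendsto (fun n : ℕ => (n:ℝ) * α n) atTop atTop

/-- Assumption 2 of Bogdan et al.: `p_n → 0`, `u_n = ψ_n² → ∞`,
`log v_n / u_n → C ∈ (0,∞)` with `v_n = u_n f_n²`, `f_n = (1-p_n)/p_n`. -/
def Assump2 (p u : ℕ → ℝ) (C : ℝ) : Prop :=
  Tendsto p atTop (nhds 0) ∧ Tendsto u atTop atTop ∧ 0 < C ∧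
    Tendsto (fun n => Real.log (u n * ((1 - p n)/p n)^2) / u n) atTop (nhds C)

/-- Standard normal cdf. -/
def Phi (z : ℝ) : ℝ := ((gaussianReal 0 1) (Set.Iic z)).toReal

/-- Squared threshold of the Bayes Oracle. -/
def csq (p u : ℕ → ℝ) (n : ℕ) : ℝ :=
  ((1 + u n)/u n) * (Real.log (1 + u n) + 2 * Real.log ((1 - p n)/p n))

/-- Type I error of the Bayes Oracle. -/
def t1BO (p u : ℕ → ℝ) (n : ℕ) : ℝ :=
  ((gaussianReal 0 1) {x : ℝ | csq p u n < x^2}).toReal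

/-- Type II error of the Bayes Oracle. -/
def t2BO (p u : ℕ → ℝ) (n : ℕ) : ℝ :=
  ((gaussianReal 0 (Real.toNNReal (1 + u n))) {x : ℝ | x^2 ≤ csq p u n}).toReal

/-- Bayes risk of the Bayes Oracle. -/
def RBO (p u : ℕ → ℝ) (n : ℕ) : ℝ :=
  (n:ℝ) * ((1 - p n) * t1BO p u n + p n * t2BO p u n)

end PaperGL

namespace PaperGL

lemma one_add_rpow_neg_half_mem {u : ℝ} (hu : 0 ≤ u) :
    0 < (1 + u) ^ (-(1:ℝ)/2) ∧ (1 + u) ^ (-(1:ℝ)/2) ≤ 1 :=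
  ⟨rpow_pos_of_pos (by linarith) _,
    rpow_le_one_of_one_le_of_nonpos (by linarith) (by norm_num)⟩

lemma div_one_add_self_mem {u : ℝ} (hu : 0 ≤ u) : 0 ≤ u / (1 + u) ∧ u / (1 + u) ≤ 1 :=
  ⟨by positivity, (div_le_one (by linarith)).2 (by linarith)⟩

/-- The damped mass `∫ (1 + tτ²)^(-1/2) t^(-a-1) L t dt`, i.e. the normalising constant of the
posterior of `κ` at `x = 0`. -/
def dampedMass (a : ℝ) (L : ℝ → ℝ) (τ : ℝ) : ℝ :=
  ∫ t in Ioi (0:ℝ), (1 + t*τ^2) ^ (-(1:ℝ)/2) * (t ^ (-a-1) * L t)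

variable {a : ℝ} {L : ℝ → ℝ}

lemma weight_pos (hLpos : ∀ t, 0 < t → 0 < L t) {t : ℝ} (ht : 0 < t) : 0 < t ^ (-a-1) * L t :=
  mul_pos (rpow_pos_of_pos ht _) (hLpos t ht)

lemma integrableOn_mul_weight (hI : IntegrableOn (fun t => t ^ (-a-1) * L t) (Ioi (0:ℝ)))
    {g : ℝ → ℝ} (hg : Measurable g) {C : ℝ} (hC : ∀ t, 0 < t → |g t| ≤ C) :
    IntegrableOn (fun t => g t * (t ^ (-a-1) * L t)) (Ioi (0:ℝ)) := by
  refine Integrable.bdd_mul (c := C) hI hg.aestronglyMeasurable ?_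
  filter_upwards [ae_restrict_mem measurableSet_Ioi] with t ht
  exact hC t ht

lemma integrableOn_damped_weight (hI : IntegrableOn (fun t => t ^ (-a-1) * L t) (Ioi (0:ℝ)))
    (τ : ℝ) :
    IntegrableOn (fun t => (1 + t*τ^2) ^ (-(1:ℝ)/2) * (t ^ (-a-1) * L t)) (Ioi (0:ℝ)) := by
  refine integrableOn_mul_weight hI (by fun_prop) (C := 1) fun t ht => ?_
  have h := one_add_rpow_neg_half_mem (u := t*τ^2) (by positivity)
  rw [abs_of_pos h.1]
  exact h.2

lemma dampedMass_pos (hLpos : ∀ t, 0 < t → 0 < L t)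
    (hI : IntegrableOn (fun t => t ^ (-a-1) * L t) (Ioi (0:ℝ))) (τ : ℝ) :
    0 < dampedMass a L τ := by
  have hpos : ∀ t ∈ Ioi (0:ℝ), 0 < (1 + t*τ^2) ^ (-(1:ℝ)/2) * (t ^ (-a-1) * L t) := fun t ht =>
    mul_pos (one_add_rpow_neg_half_mem (mul_nonneg (le_of_lt ht) (sq_nonneg τ))).1
      (weight_pos hLpos ht)
  rw [dampedMass, setIntegral_pos_iff_support_of_nonneg_ae
    ((ae_restrict_mem measurableSet_Ioi).mono fun t ht => (hpos t ht).le)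
    (integrableOn_damped_weight hI τ),
    inter_eq_right.2 fun t ht => Function.mem_support.2 (hpos t ht).ne']
  simp

lemma tendsto_dampedMass (hLpos : ∀ t, 0 < t → 0 < L t)
    (hI : IntegrableOn (fun t => t ^ (-a-1) * L t) (Ioi (0:ℝ))) :
    Tendsto (dampedMass a L) (nhdsWithin 0 (Ioi 0))
      (nhds (∫ t in Ioi (0:ℝ), t ^ (-a-1) * L t)) := by
  refine tendsto_integral_filter_of_dominated_convergence (fun t => t ^ (-a-1) * L t)
    (Eventually.of_forall fun τ => (integrableOn_damped_weight hI τ).aestronglyMeasurable)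
    (Eventually.of_forall fun τ => ?_) hI ?_
  · filter_upwards [ae_restrict_mem measurableSet_Ioi] with t ht
    have h := one_add_rpow_neg_half_mem (mul_nonneg (le_of_lt ht) (sq_nonneg τ))
    have hw := weight_pos (a := a) hLpos ht
    rw [norm_of_nonneg (mul_pos h.1 hw).le]
    exact mul_le_of_le_one_left hw.le h.2
  · refine Eventually.of_forall fun t => ?_
    have hc : ContinuousAt (fun τ : ℝ => (1 + t*τ^2) ^ (-(1:ℝ)/2) * (t ^ (-a-1) * L t)) 0 :=
      (ContinuousAt.rpow_const (by fun_prop) (Or.inl (by simp))).mul continuousAt_const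
    simpa using hc.tendsto.mono_left nhdsWithin_le_nhds

lemma dampedMass_le_denominator (hLpos : ∀ t, 0 < t → 0 < L t)
    (hI : IntegrableOn (fun t => t ^ (-a-1) * L t) (Ioi (0:ℝ))) (τ x : ℝ) :
    dampedMass a L τ ≤ ∫ t in Ioi (0:ℝ),
      (1 + t*τ^2) ^ (-(1:ℝ)/2) * t ^ (-a-1) * L t *
        Real.exp ((x^2/2) * (t*τ^2/(1+t*τ^2))) := by
  have hint : IntegrableOn (fun t => (1 + t*τ^2) ^ (-(1:ℝ)/2) * t ^ (-a-1) * L t *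
      Real.exp ((x^2/2) * (t*τ^2/(1+t*τ^2)))) (Ioi (0:ℝ)) := by
    refine (integrableOn_mul_weight hI (C := Real.exp (x^2/2))
      (g := fun t => (1 + t*τ^2) ^ (-(1:ℝ)/2) * Real.exp ((x^2/2) * (t*τ^2/(1+t*τ^2))))
      (by fun_prop) fun t ht => ?_).congr_fun (fun t _ => by ring) measurableSet_Ioi
    have hu : 0 ≤ t*τ^2 := by positivity
    have h := one_add_rpow_neg_half_mem hu
    rw [abs_of_pos (mul_pos h.1 (exp_pos _))]
    refine (mul_le_of_le_one_left (exp_pos _).le h.2).trans (exp_le_exp.2 ?_)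
    exact mul_le_of_le_one_right (by positivity) (div_one_add_self_mem hu).2
  refine setIntegral_mono_on (integrableOn_damped_weight hI τ) hint measurableSet_Ioi
    fun t ht => ?_
  have hu : 0 ≤ t*τ^2 := mul_nonneg (le_of_lt ht) (sq_nonneg τ)
  rw [mul_assoc ((1 + t*τ^2) ^ (-(1:ℝ)/2))]
  refine le_mul_of_one_le_right
    (mul_pos (one_add_rpow_neg_half_mem hu).1 (weight_pos hLpos ht)).le (one_le_exp ?_)
  exact mul_nonneg (by positivity) (div_one_add_self_mem hu).1

lemma numerator_integrand_eq (τ x : ℝ) {t : ℝ} (ht : 0 < t) :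
    τ^2 * ((1 + t*τ^2) ^ (-(3:ℝ)/2) * t ^ (-a) * L t *
        Real.exp ((x^2/2) * (t*τ^2/(1+t*τ^2)))) =
      (t*τ^2/(1+t*τ^2)) * (1+t*τ^2) ^ (-(1:ℝ)/2) * t ^ (-a-1) * L t *
        Real.exp ((x^2/2) * (t*τ^2/(1+t*τ^2))) := by
  have hp : 0 < 1 + t*τ^2 := by positivity
  have h1 : (1 + t*τ^2) ^ (-(3:ℝ)/2) = (1+t*τ^2) ^ (-(1:ℝ)/2) / (1+t*τ^2) := by
    rw [← rpow_sub_one hp.ne']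
    norm_num
  have h2 : t ^ (-a) = t ^ (-a-1) * t := by
    rw [rpow_sub_one ht.ne', div_mul_cancel₀ _ ht.ne']
  rw [h1, h2]
  ring

lemma integrableOn_numerator (hI : IntegrableOn (fun t => t ^ (-a-1) * L t) (Ioi (0:ℝ)))
    (τ x : ℝ) :
    IntegrableOn (fun t => (t*τ^2/(1+t*τ^2)) * (1+t*τ^2) ^ (-(1:ℝ)/2) * t ^ (-a-1) * L t *
        Real.exp ((x^2/2) * (t*τ^2/(1+t*τ^2)))) (Ioi (0:ℝ)) := by
  refine (integrableOn_mul_weight hI (C := Real.exp (x^2/2))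
    (g := fun t => (t*τ^2/(1+t*τ^2)) * (1+t*τ^2) ^ (-(1:ℝ)/2) *
      Real.exp ((x^2/2) * (t*τ^2/(1+t*τ^2))))
    (by fun_prop) fun t ht => ?_).congr_fun (fun t _ => by ring) measurableSet_Ioi
  have hu : 0 ≤ t*τ^2 := by positivity
  have h := one_add_rpow_neg_half_mem hu
  have hv := div_one_add_self_mem hu
  rw [abs_of_nonneg (mul_nonneg (mul_nonneg hv.1 h.1.le) (exp_pos _).le)]
  refine (mul_le_of_le_one_left (exp_pos _).le (mul_le_one₀ hv.2 h.1.le h.2)).trans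
    (exp_le_exp.2 ?_)
  exact mul_le_of_le_one_right (by positivity) hv.2

lemma numerator_le (hLpos : ∀ t, 0 < t → 0 < L t)
    (hI : IntegrableOn (fun t => t ^ (-a-1) * L t) (Ioi (0:ℝ)))
    {τ : ℝ} (hτ : τ ∈ Ioo (0:ℝ) 1) (x : ℝ) :
    τ^2 * ∫ t in Ioi (0:ℝ),
        (1 + t*τ^2) ^ (-(3:ℝ)/2) * t ^ (-a) * L t *
          Real.exp ((x^2/2) * (t*τ^2/(1+t*τ^2))) ≤
      τ^2 * Real.exp (x^2/4) * (∫ t in Ioi (0:ℝ), t ^ (-a-1) * L t) +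
        ∫ t in Ioi (1:ℝ), (t*τ^2/(1+t*τ^2)) * (1+t*τ^2) ^ (-(1:ℝ)/2) * t ^ (-a-1) * L t *
          Real.exp ((x^2/2) * (t*τ^2/(1+t*τ^2))) := by
  have hN := integrableOn_numerator hI τ x
  have hsub : Ioc (0:ℝ) 1 ⊆ Ioi 0 := fun t ht => ht.1
  rw [← integral_const_mul, setIntegral_congr_fun measurableSet_Ioi
    (fun t ht => numerator_integrand_eq τ x ht), ← Ioc_union_Ioi_eq_Ioi (zero_le_one' ℝ),
    setIntegral_union (Ioc_disjoint_Ioi le_rfl) measurableSet_Ioi (hN.mono_set hsub)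
      (hN.mono_set (Ioi_subset_Ioi zero_le_one)), Ioc_union_Ioi_eq_Ioi (zero_le_one' ℝ)]
  refine add_le_add_left ?_ _
  calc _ ≤ ∫ t in Ioc (0:ℝ) 1, τ^2 * Real.exp (x^2/4) * (t ^ (-a-1) * L t) := by
        refine setIntegral_mono_on (hN.mono_set hsub) ((hI.mono_set hsub).const_mul _)
          measurableSet_Ioc fun t ht => ?_
        have hu : 0 ≤ t*τ^2 := mul_nonneg ht.1.le (sq_nonneg τ)
        have h := one_add_rpow_neg_half_mem hu
        have hv := div_one_add_self_mem hu
        have hw := weight_pos (a := a) hLpos ht.1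
        have hτ1 : τ^2 ≤ 1 := pow_le_one₀ hτ.1.le hτ.2.le
        have hv2 : t*τ^2/(1+t*τ^2) ≤ τ^2 :=
          (div_le_self hu (by linarith)).trans (mul_le_of_le_one_left (sq_nonneg τ) ht.2)
        have hv3 : t*τ^2/(1+t*τ^2) ≤ 1/2 := by
          rw [div_le_div_iff₀ (by linarith) two_pos]
          nlinarith [mul_le_one₀ ht.2 (sq_nonneg τ) hτ1]
        have he : Real.exp ((x^2/2) * (t*τ^2/(1+t*τ^2))) ≤ Real.exp (x^2/4) :=
          exp_le_exp.2 (by nlinarith [sq_nonneg x])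
        have hg : (t*τ^2/(1+t*τ^2)) * (1+t*τ^2) ^ (-(1:ℝ)/2) ≤ τ^2 :=
          (mul_le_of_le_one_right hv.1 h.2).trans hv2
        calc _ = (t*τ^2/(1+t*τ^2)) * (1+t*τ^2) ^ (-(1:ℝ)/2) *
              Real.exp ((x^2/2) * (t*τ^2/(1+t*τ^2))) * (t ^ (-a-1) * L t) := by ring
          _ ≤ _ := by gcongr
    _ ≤ ∫ t in Ioi (0:ℝ), τ^2 * Real.exp (x^2/4) * (t ^ (-a-1) * L t) := by
        refine setIntegral_mono_set (hI.const_mul _) ?_ hsub.eventuallyLE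
        filter_upwards [ae_restrict_mem measurableSet_Ioi] with t ht
        exact mul_nonneg (by positivity) (weight_pos hLpos ht).le
    _ = _ := integral_const_mul _ _

end PaperGL

open PaperGL MeasureTheory ProbabilityTheory Real Filter Set in
/-- sharper bound (Lemma 1) on the posterior mean of `1−κ` for `a ≥ 1`. -/
theorem stmt0 (a : ℝ) (ha : 1 ≤ a) (L : ℝ → ℝ) (Mb c0 t0 K : ℝ)
    (hL : AssumpL L Mb c0 t0) (hK : Kcond a L K) :
    ∃ ε : ℝ → ℝ, Tendsto ε (nhdsWithin 0 (Set.Ioi 0)) (nhds 0) ∧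
      ∀ τ ∈ Set.Ioo (0:ℝ) 1, ∀ x : ℝ,
        E1mKt a L x τ ≤
          (τ^2 * Real.exp (x^2/4) +
            K * ∫ t in Set.Ioi (1:ℝ),
              (t*τ^2/(1+t*τ^2)) * (1+t*τ^2) ^ (-(1:ℝ)/2) * t ^ (-a-1) * L t *
                Real.exp ((x^2/2) * (t*τ^2/(1+t*τ^2)))) * (1 + ε τ) := by
  obtain ⟨-, hLpos, -⟩ := hL
  obtain ⟨hI, hJ, rfl⟩ := hK
  set J := ∫ t in Ioi (0:ℝ), t ^ (-a-1) * L t with hJdef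
  refine ⟨fun τ => J / dampedMass a L τ - 1, ?_, fun τ hτ x => ?_⟩
  · have h := (tendsto_const_nhds (x := J)).div (tendsto_dampedMass hLpos hI) hJ.ne'
    simpa [← hJdef, div_self hJ.ne'] using h.sub_const 1
  · have hD := dampedMass_pos hLpos hI τ
    have hN := numerator_le hLpos hI hτ x
    rw [← hJdef] at hN
    have hR : 0 ≤ ∫ t in Ioi (1:ℝ), (t*τ^2/(1+t*τ^2)) * (1+t*τ^2) ^ (-(1:ℝ)/2) * t ^ (-a-1) *
        L t * Real.exp ((x^2/2) * (t*τ^2/(1+t*τ^2))) := by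
      refine setIntegral_nonneg measurableSet_Ioi fun t ht => ?_
      have ht0 : 0 < t := zero_lt_one.trans ht
      have := hLpos t ht0
      positivity
    refine (div_le_div₀ (by positivity) hN hD (dampedMass_le_denominator hLpos hI τ x)).trans_eq ?_
    generalize (∫ t in Ioi (1:ℝ), (t*τ^2/(1+t*τ^2)) * (1+t*τ^2) ^ (-(1:ℝ)/2) * t ^ (-a-1) *
        L t * Real.exp ((x^2/2) * (t*τ^2/(1+t*τ^2)))) = R
    field_simp
    ring
end
end

section
/- Suppose a ≥ 1/2 and L satisfies Assumptions A1 and A2. Then there exists a constant C > 0 such that for all sufficiently large n, sup_{θ0 ∈ ℓ0[q_n]} E_{θ0} Σ_{i=1}^n Var(θ_i | X_i, τ̂) ≤ C q_n log n, where Var(θ_i|X_i,τ̂) denotes Var(θ_i|X_i,τ) evaluated at τ = τ̂. -/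
open MeasureTheory ProbabilityTheory Real Filter Set

noncomputable section

namespace PaperGL

/-- The mixing density of `κ` without the likelihood factors `κ^(1/2) exp((1-κ)x²/2)`. -/
def mixDens (a : ℝ) (L : ℝ → ℝ) (τ κ : ℝ) : ℝ :=
  κ ^ (a - 1) * (1 - κ) ^ (-a - 1) * L ((1/τ^2) * (1/κ - 1))

lemma hasDerivWithinAt_kappa (τ κ : ℝ) (hκ : κ ∈ Ioo (0:ℝ) 1) :
    HasDerivWithinAt (fun κ : ℝ => (1/τ^2) * (1/κ - 1)) (-((1/τ^2)/κ^2)) (Ioo 0 1) κ := by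
  have h := (((hasDerivAt_inv hκ.1.ne').sub_const 1).const_mul (1/τ^2)).hasDerivWithinAt
    (s := Ioo (0:ℝ) 1)
  simp only [one_div] at h ⊢
  exact h.congr_deriv (by ring)

lemma injOn_kappa {τ : ℝ} (hτ : 0 < τ) :
    InjOn (fun κ : ℝ => (1/τ^2) * (1/κ - 1)) (Ioo 0 1) := by
  intro x _ y _ hxy
  have h1 : (1/τ^2) ≠ 0 := by positivity
  have h2 := mul_left_cancel₀ h1 hxy
  have h3 : 1/x = 1/y := by linarith
  simpa using h3

lemma image_kappa {τ : ℝ} (hτ : 0 < τ) :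
    (fun κ : ℝ => (1/τ^2) * (1/κ - 1)) '' Ioo 0 1 = Ioi 0 := by
  ext t
  constructor
  · rintro ⟨κ, ⟨h0, h1⟩, rfl⟩
    have : 1 < 1/κ := by rw [lt_div_iff₀ h0]; linarith
    have h2 : 0 < 1/κ - 1 := by linarith
    show 0 < (1/τ^2) * (1/κ - 1)
    positivity
  · intro ht
    have ht : 0 < t := ht
    have : 0 < t * τ^2 := by positivity
    refine ⟨1/(1 + t*τ^2), ⟨by positivity, ?_⟩, ?_⟩
    · rw [div_lt_one (by positivity)]; linarith
    · field_simp
      ring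

lemma integrableOn_kappa_iff {τ : ℝ} (hτ : 0 < τ) (g : ℝ → ℝ) :
    IntegrableOn g (Ioi 0) ↔
      IntegrableOn (fun κ => ((1/τ^2)/κ^2) * g ((1/τ^2) * (1/κ - 1))) (Ioo 0 1) := by
  rw [← image_kappa hτ, integrableOn_image_iff_integrableOn_abs_deriv_smul measurableSet_Ioo
    (hasDerivWithinAt_kappa τ) (injOn_kappa hτ)]
  refine integrableOn_congr_fun (fun κ _ => ?_) measurableSet_Ioo
  simp only [abs_neg, smul_eq_mul]
  rw [abs_of_nonneg (by positivity)]

lemma integral_kappa {τ : ℝ} (hτ : 0 < τ) (g : ℝ → ℝ) :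
    ∫ t in Ioi 0, g t =
      ∫ κ in Ioo (0:ℝ) 1, ((1/τ^2)/κ^2) * g ((1/τ^2) * (1/κ - 1)) := by
  rw [← image_kappa hτ, integral_image_eq_integral_abs_deriv_smul measurableSet_Ioo
    (hasDerivWithinAt_kappa τ) (injOn_kappa hτ)]
  refine setIntegral_congr_fun measurableSet_Ioo (fun κ _ => ?_)
  simp only [abs_neg, smul_eq_mul]
  rw [abs_of_nonneg (by positivity)]

lemma kappa_pos {τ κ : ℝ} (hτ : 0 < τ) (hκ : κ ∈ Ioo (0:ℝ) 1) : 0 < (1/τ^2) * (1/κ - 1) := by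
  have h := mem_image_of_mem (fun κ : ℝ => (1/τ^2) * (1/κ - 1)) hκ
  rwa [image_kappa hτ] at h

lemma jacobian_mul_eq_mixDens (a : ℝ) (L : ℝ → ℝ) {τ κ : ℝ} (hτ : 0 < τ)
    (hκ : κ ∈ Ioo (0:ℝ) 1) :
    ((1/τ^2)/κ^2) * (((1/τ^2) * (1/κ - 1)) ^ (-a-1) * L ((1/τ^2) * (1/κ - 1))) =
      τ ^ (2*a) * mixDens a L τ κ := by
  obtain ⟨h0, h1⟩ := hκ
  have hw : 0 < 1 - κ := by linarith
  have e1 : (1/τ^2) * (1/κ - 1) = (1 - κ) * (τ^2 * κ)⁻¹ := by field_simp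
  have e2 : ((1 - κ) * (τ^2 * κ)⁻¹) ^ (-a-1) = (1-κ)^(-a-1) * (τ^(2*a) * τ^2 * (κ^(a-1) * κ^2)) := by
    rw [Real.mul_rpow hw.le (by positivity), Real.inv_rpow (by positivity),
      ← Real.rpow_neg (by positivity), Real.mul_rpow (by positivity) h0.le]
    congr 2
    · rw [← Real.rpow_natCast, ← Real.rpow_mul hτ.le, ← Real.rpow_add hτ]
      congr 1; push_cast; ring
    · rw [← Real.rpow_natCast κ 2, ← Real.rpow_add h0]
      congr 1; push_cast; ring
  unfold mixDens
  rw [e1, e2]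
  field_simp

lemma integrableOn_mixDens {a : ℝ} {L : ℝ → ℝ} {τ : ℝ} (hτ : 0 < τ)
    (hI : IntegrableOn (fun t => t ^ (-a-1) * L t) (Ioi (0:ℝ))) :
    IntegrableOn (mixDens a L τ) (Ioo 0 1) := by
  rw [integrableOn_kappa_iff hτ] at hI
  rw [integrableOn_congr_fun (fun κ hκ => jacobian_mul_eq_mixDens a L hτ hκ) measurableSet_Ioo] at hI
  have h2 := hI.const_mul (τ ^ (2*a))⁻¹
  refine h2.congr (ae_of_all _ fun κ => ?_)
  have : τ ^ (2*a) ≠ 0 := (Real.rpow_pos_of_pos hτ _).ne'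
  field_simp

lemma integral_mixDens {a : ℝ} {L : ℝ → ℝ} {τ : ℝ} (hτ : 0 < τ) :
    ∫ κ in Ioo (0:ℝ) 1, mixDens a L τ κ = τ ^ (-(2*a)) * ∫ t in Ioi (0:ℝ), t ^ (-a-1) * L t := by
  rw [integral_kappa hτ, setIntegral_congr_fun measurableSet_Ioo
    (fun κ hκ => jacobian_mul_eq_mixDens a L hτ hκ), integral_const_mul, ← mul_assoc,
    ← Real.rpow_add hτ]
  simp

lemma kdens_eq_mixDens (a : ℝ) (L : ℝ → ℝ) (x τ : ℝ) {κ : ℝ} (hκ : κ ∈ Ioo (0:ℝ) 1) :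
    kdens a L x τ κ = κ ^ (1/2 : ℝ) * mixDens a L τ κ * Real.exp ((1 - κ) * x^2 / 2) := by
  unfold kdens mixDens
  rw [← mul_assoc, ← mul_assoc, ← Real.rpow_add hκ.1]
  congr 4
  ring

lemma mixDens_nonneg {a : ℝ} {L : ℝ → ℝ} {τ κ : ℝ} (hL : ∀ t, 0 < t → 0 ≤ L t) (hτ : 0 < τ)
    (hκ : κ ∈ Ioo (0:ℝ) 1) : 0 ≤ mixDens a L τ κ := by
  have h1 := hκ.1.le
  have h2 : 0 ≤ 1 - κ := by linarith [hκ.2]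
  have h3 := hL _ (kappa_pos hτ hκ)
  unfold mixDens
  positivity

lemma kdens_nonneg {a : ℝ} {L : ℝ → ℝ} {x τ κ : ℝ} (hL : ∀ t, 0 < t → 0 ≤ L t) (hτ : 0 < τ)
    (hκ : κ ∈ Ioo (0:ℝ) 1) : 0 ≤ kdens a L x τ κ := by
  have h1 := hκ.1.le
  have h3 := mixDens_nonneg (a := a) hL hτ hκ
  rw [kdens_eq_mixDens a L x τ hκ]
  positivity

lemma measurable_kdens {a : ℝ} {L : ℝ → ℝ} (x τ : ℝ) (hL : Measurable L) :
    Measurable (kdens a L x τ) := by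
  unfold kdens
  fun_prop

lemma integrableOn_bounded_mul_kdens {a : ℝ} {L : ℝ → ℝ} {x τ B : ℝ} {g : ℝ → ℝ}
    (hLm : Measurable L) (hL : ∀ t, 0 < t → 0 ≤ L t) (hτ : 0 < τ)
    (hI : IntegrableOn (fun t => t ^ (-a-1) * L t) (Ioi (0:ℝ)))
    (hg : Measurable g) (hB : ∀ κ ∈ Ioo (0:ℝ) 1, |g κ| ≤ B) :
    IntegrableOn (fun κ => g κ * kdens a L x τ κ) (Ioo 0 1) := by
  refine Integrable.mono' ((integrableOn_mixDens hτ hI).const_mul (B * Real.exp (x^2/2)))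
    (hg.mul (measurable_kdens x τ hLm)).aestronglyMeasurable ?_
  refine (ae_restrict_iff' measurableSet_Ioo).2 (ae_of_all _ fun κ hκ => ?_)
  have hm := mixDens_nonneg (a := a) hL hτ hκ
  have hB0 : 0 ≤ B := (abs_nonneg _).trans (hB κ hκ)
  have h1 : κ ^ (1/2 : ℝ) ≤ 1 := Real.rpow_le_one hκ.1.le hκ.2.le (by norm_num)
  have h2 : Real.exp ((1 - κ) * x^2 / 2) ≤ Real.exp (x^2/2) := by
    apply Real.exp_le_exp.2
    nlinarith [hκ.1, sq_nonneg x]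
  have h0 : 0 ≤ κ ^ (1/2 : ℝ) := Real.rpow_nonneg hκ.1.le _
  rw [norm_mul, Real.norm_eq_abs, Real.norm_eq_abs, abs_of_nonneg (kdens_nonneg hL hτ hκ),
    kdens_eq_mixDens a L x τ hκ]
  calc |g κ| * (κ ^ (1/2 : ℝ) * mixDens a L τ κ * Real.exp ((1 - κ) * x^2 / 2))
      ≤ B * (1 * mixDens a L τ κ * Real.exp (x^2/2)) := by
        gcongr
        exact hB κ hκ
    _ = _ := by ring

lemma integrableOn_kdens {a : ℝ} {L : ℝ → ℝ} {x τ : ℝ}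
    (hLm : Measurable L) (hL : ∀ t, 0 < t → 0 ≤ L t) (hτ : 0 < τ)
    (hI : IntegrableOn (fun t => t ^ (-a-1) * L t) (Ioi (0:ℝ))) :
    IntegrableOn (kdens a L x τ) (Ioo 0 1) := by
  simpa using integrableOn_bounded_mul_kdens (x := x) (B := 1) (g := fun _ => 1) hLm hL hτ hI
    measurable_const (by simp)

lemma one_sub_le_of_kappa_le_one {τ κ : ℝ} (hτ : 0 < τ) (hκ : κ ∈ Ioo (0:ℝ) 1)
    (h : (1/τ^2) * (1/κ - 1) ≤ 1) : 1 - κ ≤ κ * τ^2 := by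
  have h0 := hκ.1
  have e : (1/τ^2) * (1/κ - 1) = (1 - κ) / (κ * τ^2) := by field_simp
  rwa [e, div_le_one (by positivity)] at h

lemma exists_integral_kdens_ge {a : ℝ} {L : ℝ → ℝ}
    (hLm : Measurable L) (hL : ∀ t, 0 < t → 0 < L t)
    (hI : IntegrableOn (fun t => t ^ (-a-1) * L t) (Ioi (0:ℝ))) :
    ∃ c : ℝ, 0 < c ∧ ∀ x τ : ℝ, 0 < τ → τ ≤ 1 →
      c * τ ^ (-(2*a)) ≤ ∫ κ in Ioo (0:ℝ) 1, kdens a L x τ κ := by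
  have hL0 : ∀ t, 0 < t → 0 ≤ L t := fun t ht => (hL t ht).le
  set L' : ℝ → ℝ := (Iic (1:ℝ)).indicator L with hL'
  have hI' : IntegrableOn (fun t => t ^ (-a-1) * L' t) (Ioi (0:ℝ)) := by
    have := hI.indicator (measurableSet_Iic (a := (1:ℝ)))
    refine this.congr (ae_of_all _ fun t => ?_)
    by_cases ht : t ∈ Iic (1:ℝ) <;> simp [hL', ht]
  have hpos : 0 < ∫ t in Ioi (0:ℝ), t ^ (-a-1) * L' t := by
    rw [setIntegral_pos_iff_support_of_nonneg_ae _ hI']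
    · refine lt_of_lt_of_le ?_ (measure_mono (s := Ioc (0:ℝ) 1) ?_)
      · simp
      · intro t ht
        refine ⟨?_, ht.1⟩
        have h1 : t ∈ Iic (1:ℝ) := ht.2
        simp only [Function.mem_support, hL', indicator_of_mem h1]
        exact (mul_pos (Real.rpow_pos_of_pos ht.1 _) (hL t ht.1)).ne'
    · refine (ae_restrict_iff' measurableSet_Ioi).2 (ae_of_all _ fun t ht => ?_)
      have ht : 0 < t := ht
      exact mul_nonneg (Real.rpow_nonneg ht.le _)
        (indicator_apply_nonneg fun _ => hL0 t ht)
  refine ⟨(1/2) * ∫ t in Ioi (0:ℝ), t ^ (-a-1) * L' t, by positivity, fun x τ hτ hτ1 => ?_⟩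
  calc (1/2) * (∫ t in Ioi (0:ℝ), t ^ (-a-1) * L' t) * τ ^ (-(2*a))
      = ∫ κ in Ioo (0:ℝ) 1, (1/2) * mixDens a L' τ κ := by
        rw [integral_const_mul, integral_mixDens hτ]; ring
    _ ≤ _ := by
        refine setIntegral_mono_on ((integrableOn_mixDens hτ hI').const_mul _)
          (integrableOn_kdens hLm hL0 hτ hI) measurableSet_Ioo fun κ hκ => ?_
        by_cases h : (1/τ^2) * (1/κ - 1) ≤ 1
        · have hw := one_sub_le_of_kappa_le_one hτ hκ h
          have hm := mixDens_nonneg (a := a) hL0 hτ hκ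
          have e : mixDens a L' τ κ = mixDens a L τ κ := by
            unfold mixDens
            rw [hL', indicator_of_mem (show _ ∈ Iic (1:ℝ) from h)]
          have h2 : (1/2 : ℝ) ≤ κ := by
            have : κ * τ^2 ≤ κ * 1 := by
              gcongr
              · exact hκ.1.le
              · exact pow_le_one₀ hτ.le hτ1
            linarith
          have h3 : κ ≤ κ ^ (1/2 : ℝ) := by
            simpa using Real.rpow_le_rpow_of_exponent_ge hκ.1 hκ.2.le
              (show (1/2 : ℝ) ≤ 1 by norm_num)
          have h4 : 1 ≤ Real.exp ((1 - κ) * x^2 / 2) := by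
            apply Real.one_le_exp
            have : 0 ≤ 1 - κ := by linarith [hκ.2]
            positivity
          rw [e, kdens_eq_mixDens a L x τ hκ, ← mul_one (1/2 * mixDens a L τ κ)]
          gcongr
          linarith
        · have e : mixDens a L' τ κ = 0 := by
            unfold mixDens
            rw [hL', indicator_of_notMem (show _ ∉ Iic (1:ℝ) from h), mul_zero]
          rw [e, mul_zero]
          exact kdens_nonneg hL0 hτ hκ

lemma shrink_mul_kdens_le {a Mb : ℝ} {L : ℝ → ℝ} (ha : 1/2 ≤ a)
    (hL : ∀ t, 0 < t → 0 ≤ L t) (hLM : ∀ t, 0 < t → L t ≤ Mb) {x τ κ : ℝ} (hτ : 0 < τ)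
    (hτ1 : τ ≤ 1) (hκ : κ ∈ Ioo (0:ℝ) 1) :
    ((1 - κ) + x^2 * (1 - κ)^2) * kdens a L x τ κ ≤
      4 * τ * Real.exp (x^2/2) * mixDens a L τ κ +
        Mb * τ ^ (1 - 2*a) *
          (Real.exp (x^2/2) * (1 - κ) ^ (-(1/2) : ℝ) + x^2 * Real.exp ((1 - κ) * x^2 / 2)) := by
  have h0 := hκ.1
  have hw : 0 < 1 - κ := by linarith [hκ.2]
  have hm := mixDens_nonneg (a := a) hL hτ hκ
  have hφ := kappa_pos hτ hκ
  have hLφ := hL _ hφ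
  have hM := hLM _ hφ
  have hM0 : 0 ≤ Mb := hLφ.trans hM
  have hx := sq_nonneg x
  by_cases h : (1/τ^2) * (1/κ - 1) ≤ 1
  · have hwκ := one_sub_le_of_kappa_le_one hτ hκ h
    have hτ2 : τ^2 ≤ τ := by nlinarith
    have h1 : 1 - κ ≤ τ := by nlinarith [hκ.2]
    have h2 : 1 - κ ≤ 1/2 := by nlinarith
    have h3 : (1 - κ) + x^2 * (1 - κ)^2 ≤ τ * (1 + x^2) := by
      have : (1 - κ)^2 ≤ τ := by nlinarith
      nlinarith
    have h4 : 1 + x^2 ≤ 4 * Real.exp (x^2/4) := by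
      have := Real.add_one_le_exp (x^2/4)
      linarith
    have h5 : Real.exp ((1 - κ) * x^2 / 2) ≤ Real.exp (x^2/4) := by
      apply Real.exp_le_exp.2
      nlinarith
    have h6 : κ ^ (1/2 : ℝ) ≤ 1 := Real.rpow_le_one h0.le hκ.2.le (by norm_num)
    have h7 : Real.exp (x^2/2) = Real.exp (x^2/4) * Real.exp (x^2/4) := by
      rw [← Real.exp_add]; congr 1; ring
    have hr : 0 ≤ Mb * τ ^ (1 - 2*a) *
        (Real.exp (x^2/2) * (1 - κ) ^ (-(1/2) : ℝ) + x^2 * Real.exp ((1 - κ) * x^2 / 2)) := by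
      positivity
    refine le_trans ?_ (le_add_of_nonneg_right hr)
    rw [kdens_eq_mixDens a L x τ hκ]
    calc ((1 - κ) + x^2 * (1 - κ)^2) *
          (κ ^ (1/2 : ℝ) * mixDens a L τ κ * Real.exp ((1 - κ) * x^2 / 2))
        ≤ (τ * (4 * Real.exp (x^2/4))) * (1 * mixDens a L τ κ * Real.exp (x^2/4)) := by
          gcongr
          exact h3.trans (by gcongr)
      _ = _ := by rw [h7]; ring
  · have hlt : 1 < (1/τ^2) * (1/κ - 1) := not_le.1 h
    have hκw : κ ≤ (1 - κ) * (1/τ^2) := by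
      have e : (1/τ^2) * (1/κ - 1) = ((1 - κ) * (1/τ^2)) / κ := by field_simp
      rw [e, lt_div_iff₀ h0] at hlt
      linarith
    have h1 : κ ^ (a - 1/2) * (1 - κ) ^ (-a - 1) ≤ τ ^ (1 - 2*a) * (1 - κ) ^ (-(3/2) : ℝ) := by
      have h2 : κ ^ (a - 1/2) ≤ (1 - κ) ^ (a - 1/2) * τ ^ (1 - 2*a) := by
        refine (Real.rpow_le_rpow h0.le hκw (by linarith)).trans_eq ?_
        rw [Real.mul_rpow hw.le (by positivity), one_div (τ^2), Real.inv_rpow (by positivity),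
          ← Real.rpow_neg (by positivity), ← Real.rpow_natCast, ← Real.rpow_mul hτ.le]
        congr 2
        push_cast
        ring
      calc κ ^ (a - 1/2) * (1 - κ) ^ (-a - 1)
          ≤ (1 - κ) ^ (a - 1/2) * τ ^ (1 - 2*a) * (1 - κ) ^ (-a - 1) := by gcongr
        _ = τ ^ (1 - 2*a) * ((1 - κ) ^ (a - 1/2) * (1 - κ) ^ (-a - 1)) := by ring
        _ = _ := by
          rw [← Real.rpow_add hw]
          congr 2
          ring
    have h3 : kdens a L x τ κ ≤
        τ ^ (1 - 2*a) * (1 - κ) ^ (-(3/2) : ℝ) * Mb * Real.exp ((1 - κ) * x^2 / 2) := by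
      unfold kdens
      gcongr
    have e1 : (1 - κ) * (1 - κ) ^ (-(3/2) : ℝ) = (1 - κ) ^ (-(1/2) : ℝ) := by
      nth_rewrite 1 [← Real.rpow_one (1 - κ)]
      rw [← Real.rpow_add hw]
      norm_num
    have e2 : (1 - κ)^2 * (1 - κ) ^ (-(3/2) : ℝ) ≤ 1 := by
      rw [← Real.rpow_natCast, ← Real.rpow_add hw]
      exact Real.rpow_le_one hw.le (by linarith) (by norm_num)
    have h5 : Real.exp ((1 - κ) * x^2 / 2) ≤ Real.exp (x^2/2) := by
      apply Real.exp_le_exp.2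
      nlinarith
    have hl : 0 ≤ 4 * τ * Real.exp (x^2/2) * mixDens a L τ κ := by positivity
    refine le_trans ?_ (le_add_of_nonneg_left hl)
    calc ((1 - κ) + x^2 * (1 - κ)^2) * kdens a L x τ κ
        ≤ ((1 - κ) + x^2 * (1 - κ)^2) *
          (τ ^ (1 - 2*a) * (1 - κ) ^ (-(3/2) : ℝ) * Mb * Real.exp ((1 - κ) * x^2 / 2)) := by
          gcongr
      _ = Mb * τ ^ (1 - 2*a) * (Real.exp ((1 - κ) * x^2 / 2) * ((1 - κ) * (1 - κ) ^ (-(3/2) : ℝ)) +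
          x^2 * (((1 - κ)^2 * (1 - κ) ^ (-(3/2) : ℝ)) * Real.exp ((1 - κ) * x^2 / 2))) := by ring
      _ ≤ Mb * τ ^ (1 - 2*a) * (Real.exp (x^2/2) * (1 - κ) ^ (-(1/2) : ℝ) +
          x^2 * (1 * Real.exp ((1 - κ) * x^2 / 2))) := by
          rw [e1]
          gcongr
      _ = _ := by ring

lemma integral_one_sub_rpow_neg_half :
    IntegrableOn (fun κ : ℝ => (1 - κ) ^ (-(1/2) : ℝ)) (Ioo 0 1) ∧
      ∫ κ in Ioo (0:ℝ) 1, (1 - κ) ^ (-(1/2) : ℝ) = 2 := by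
  have h1 : IntervalIntegrable (fun κ : ℝ => (1 - κ) ^ (-(1/2) : ℝ)) volume 0 1 := by
    have := (intervalIntegral.intervalIntegrable_rpow' (a := 1) (b := 0)
      (r := (-(1/2) : ℝ)) (by norm_num)).comp_sub_left 1
    simpa using this
  constructor
  · rw [intervalIntegrable_iff_integrableOn_Ioo_of_le zero_le_one] at h1
    exact h1
  · rw [← integral_Ioc_eq_integral_Ioo, ← intervalIntegral.integral_of_le zero_le_one,
      intervalIntegral.integral_comp_sub_left (fun x : ℝ => x ^ (-(1/2) : ℝ)),
      integral_rpow (Or.inl (by norm_num))]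
    norm_num

lemma integral_sq_mul_exp_le (x : ℝ) :
    IntegrableOn (fun κ : ℝ => x^2 * Real.exp ((1 - κ) * x^2 / 2)) (Ioo 0 1) ∧
      ∫ κ in Ioo (0:ℝ) 1, x^2 * Real.exp ((1 - κ) * x^2 / 2) ≤ 2 * Real.exp (x^2/2) := by
  have hc : Continuous (fun κ : ℝ => x^2 * Real.exp ((1 - κ) * x^2 / 2)) := by fun_prop
  refine ⟨(hc.integrableOn_Icc (a := 0) (b := 1)).mono_set Ioo_subset_Icc_self, ?_⟩
  rw [← integral_Ioc_eq_integral_Ioo, ← intervalIntegral.integral_of_le zero_le_one,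
    intervalIntegral.integral_eq_sub_of_hasDerivAt
      (f := fun κ => -2 * Real.exp ((1 - κ) * x^2 / 2)) _ (hc.intervalIntegrable _ _)]
  · simp
  · intro κ _
    have h1 : HasDerivAt (fun κ : ℝ => (1 - κ) * x^2 / 2) (-1 * x^2 / 2) κ :=
      (((hasDerivAt_id κ).const_sub 1).mul_const _).div_const _
    exact (h1.exp.const_mul (-2)).congr_deriv (by ring)

lemma postVar_le_shrink_div {a : ℝ} {L : ℝ → ℝ} {x τ : ℝ}
    (hLm : Measurable L) (hL : ∀ t, 0 < t → 0 ≤ L t) (hτ : 0 < τ)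
    (hI : IntegrableOn (fun t => t ^ (-a-1) * L t) (Ioi (0:ℝ))) :
    postVar a L x τ ≤ (∫ κ in Ioo (0:ℝ) 1, ((1 - κ) + x^2 * (1 - κ)^2) * kdens a L x τ κ) /
      ∫ κ in Ioo (0:ℝ) 1, kdens a L x τ κ := by
  have i1 : IntegrableOn (fun κ => (1 - κ) * kdens a L x τ κ) (Ioo 0 1) :=
    integrableOn_bounded_mul_kdens (B := 1) hLm hL hτ hI (by fun_prop)
      (fun κ hκ => abs_le.2 ⟨by linarith [hκ.2], by linarith [hκ.1]⟩)
  have i2 : IntegrableOn (fun κ => (1 - κ)^2 * kdens a L x τ κ) (Ioo 0 1) :=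
    integrableOn_bounded_mul_kdens (B := 1) hLm hL hτ hI (by fun_prop)
      (fun κ hκ => abs_le.2 ⟨by nlinarith [hκ.2], by nlinarith [hκ.1, hκ.2]⟩)
  have e : ∫ κ in Ioo (0:ℝ) 1, ((1 - κ) + x^2 * (1 - κ)^2) * kdens a L x τ κ =
      (∫ κ in Ioo (0:ℝ) 1, (1 - κ) * kdens a L x τ κ) +
        x^2 * ∫ κ in Ioo (0:ℝ) 1, (1 - κ)^2 * kdens a L x τ κ := by
    rw [← integral_const_mul, ← integral_add i1 (i2.const_mul _)]
    congr 1
    ext κ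
    ring
  rw [e, add_div, mul_div_assoc]
  unfold postVar E1mK kExp
  gcongr
  nlinarith [sq_nonneg ((∫ κ in Ioo (0:ℝ) 1, (1 - κ) * kdens a L x τ κ) /
    ∫ κ in Ioo (0:ℝ) 1, kdens a L x τ κ)]

lemma exists_postVar_le_mul_exp {a Mb : ℝ} {L : ℝ → ℝ} (ha : 1/2 ≤ a)
    (hLm : Measurable L) (hL : ∀ t, 0 < t → 0 < L t) (hLM : ∀ t, 0 < t → L t ≤ Mb)
    (hI : IntegrableOn (fun t => t ^ (-a-1) * L t) (Ioi (0:ℝ))) :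
    ∃ C : ℝ, 0 < C ∧ ∀ x τ : ℝ, 0 < τ → τ ≤ 1 → postVar a L x τ ≤ C * τ * Real.exp (x^2/2) := by
  obtain ⟨c, hc, hD⟩ := exists_integral_kdens_ge hLm hL hI
  have hL0 : ∀ t, 0 < t → 0 ≤ L t := fun t ht => (hL t ht).le
  have hM0 : 0 < Mb := (hL 1 one_pos).trans_le (hLM 1 one_pos)
  set I := ∫ t in Ioi (0:ℝ), t ^ (-a-1) * L t with hIdef
  have hI0 : 0 ≤ I := setIntegral_nonneg measurableSet_Ioi fun t ht =>
    mul_nonneg (Real.rpow_nonneg (le_of_lt ht) _) (hL0 t ht)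
  refine ⟨(4 * I + 4 * Mb) / c, by positivity, fun x τ hτ hτ1 => ?_⟩
  have hτp : 0 < τ ^ (-(2*a)) := Real.rpow_pos_of_pos hτ _
  have hDx := hD x τ hτ hτ1
  have hD0 : 0 < ∫ κ in Ioo (0:ℝ) 1, kdens a L x τ κ := (by positivity : (0:ℝ) < c * τ ^ (-(2*a))).trans_le hDx
  refine (postVar_le_shrink_div hLm hL0 hτ hI).trans ?_
  rw [div_le_iff₀ hD0]
  obtain ⟨i1, e1⟩ := integral_one_sub_rpow_neg_half
  obtain ⟨i2, e2⟩ := integral_sq_mul_exp_le x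
  have eτ : τ ^ (1 - 2*a) = τ * τ ^ (-(2*a)) := by
    rw [sub_eq_add_neg, Real.rpow_add hτ, Real.rpow_one]
  have j1 := (integrableOn_mixDens hτ hI).const_mul (4 * τ * Real.exp (x^2/2))
  have j2 : IntegrableOn (fun κ => Mb * τ ^ (1 - 2*a) *
      (Real.exp (x^2/2) * (1 - κ) ^ (-(1/2) : ℝ) + x^2 * Real.exp ((1 - κ) * x^2 / 2))) (Ioo 0 1) :=
    ((i1.const_mul (Real.exp (x^2/2))).add i2).const_mul (Mb * τ ^ (1 - 2*a))
  have hnum : ∫ κ in Ioo (0:ℝ) 1, ((1 - κ) + x^2 * (1 - κ)^2) * kdens a L x τ κ ≤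
      (4 * I + 4 * Mb) * τ * Real.exp (x^2/2) * τ ^ (-(2*a)) := by
    calc ∫ κ in Ioo (0:ℝ) 1, ((1 - κ) + x^2 * (1 - κ)^2) * kdens a L x τ κ
        ≤ ∫ κ in Ioo (0:ℝ) 1, (4 * τ * Real.exp (x^2/2) * mixDens a L τ κ +
          Mb * τ ^ (1 - 2*a) * (Real.exp (x^2/2) * (1 - κ) ^ (-(1/2) : ℝ) +
            x^2 * Real.exp ((1 - κ) * x^2 / 2))) := by
          refine setIntegral_mono_on ?_ (j1.add j2) measurableSet_Ioo
            fun κ hκ => shrink_mul_kdens_le ha hL0 hLM hτ hτ1 hκ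
          refine integrableOn_bounded_mul_kdens (B := 1 + x^2) hLm hL0 hτ hI (by fun_prop)
            fun κ hκ => ?_
          have hw : 0 ≤ 1 - κ := by linarith [hκ.2]
          have hw1 : 1 - κ ≤ 1 := by linarith [hκ.1]
          rw [abs_of_nonneg (by positivity)]
          have : (1 - κ)^2 ≤ 1 := pow_le_one₀ hw hw1
          nlinarith [sq_nonneg x]
      _ = 4 * τ * Real.exp (x^2/2) * (τ ^ (-(2*a)) * I) + Mb * τ ^ (1 - 2*a) *
          (Real.exp (x^2/2) * 2 + ∫ κ in Ioo (0:ℝ) 1, x^2 * Real.exp ((1 - κ) * x^2 / 2)) := by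
          rw [integral_add j1 j2, integral_const_mul, integral_const_mul,
            integral_add (i1.const_mul _) i2, integral_const_mul, e1, integral_mixDens hτ]
      _ ≤ 4 * τ * Real.exp (x^2/2) * (τ ^ (-(2*a)) * I) + Mb * τ ^ (1 - 2*a) *
          (Real.exp (x^2/2) * 2 + 2 * Real.exp (x^2/2)) := by gcongr
      _ = _ := by rw [eτ]; ring
  refine hnum.trans ?_
  calc (4 * I + 4 * Mb) * τ * Real.exp (x^2/2) * τ ^ (-(2*a))
      = (4 * I + 4 * Mb) / c * τ * Real.exp (x^2/2) * (c * τ ^ (-(2*a))) := by field_simp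
    _ ≤ _ := by gcongr

lemma postVar_le_one_add {a : ℝ} {L : ℝ → ℝ} {x τ : ℝ}
    (hLm : Measurable L) (hL : ∀ t, 0 < t → 0 ≤ L t) (hτ : 0 < τ)
    (hI : IntegrableOn (fun t => t ^ (-a-1) * L t) (Ioi (0:ℝ)))
    (hD : 0 < ∫ κ in Ioo (0:ℝ) 1, kdens a L x τ κ) :
    postVar a L x τ ≤ 1 + x^2 * ((∫ κ in Ioo (0:ℝ) 1, κ^2 * kdens a L x τ κ) /
      ∫ κ in Ioo (0:ℝ) 1, kdens a L x τ κ) := by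
  have i0 := integrableOn_kdens (x := x) hLm hL hτ hI
  have i1 : IntegrableOn (fun κ => κ * kdens a L x τ κ) (Ioo 0 1) :=
    integrableOn_bounded_mul_kdens (B := 1) hLm hL hτ hI (by fun_prop)
      (fun κ hκ => abs_le.2 ⟨by linarith [hκ.1], by linarith [hκ.2]⟩)
  have i2 : IntegrableOn (fun κ => κ^2 * kdens a L x τ κ) (Ioo 0 1) :=
    integrableOn_bounded_mul_kdens (B := 1) hLm hL hτ hI (by fun_prop)
      (fun κ hκ => abs_le.2 ⟨by nlinarith [hκ.1], by nlinarith [hκ.1, hκ.2]⟩)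
  have e1 : ∫ κ in Ioo (0:ℝ) 1, (1 - κ) * kdens a L x τ κ =
      (∫ κ in Ioo (0:ℝ) 1, kdens a L x τ κ) - ∫ κ in Ioo (0:ℝ) 1, κ * kdens a L x τ κ := by
    rw [← integral_sub i0 i1]
    congr 1
    ext κ
    ring
  have e2 : ∫ κ in Ioo (0:ℝ) 1, (1 - κ)^2 * kdens a L x τ κ =
      (∫ κ in Ioo (0:ℝ) 1, kdens a L x τ κ) - 2 * (∫ κ in Ioo (0:ℝ) 1, κ * kdens a L x τ κ) +
        ∫ κ in Ioo (0:ℝ) 1, κ^2 * kdens a L x τ κ := by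
    have i3 : IntegrableOn (fun κ => kdens a L x τ κ - 2 * (κ * kdens a L x τ κ)) (Ioo 0 1) :=
      i0.sub (i1.const_mul 2)
    rw [← integral_const_mul, ← integral_sub i0 (i1.const_mul 2), ← integral_add i3 i2]
    congr 1
    ext κ
    ring
  have hA : 0 ≤ ∫ κ in Ioo (0:ℝ) 1, κ * kdens a L x τ κ :=
    setIntegral_nonneg measurableSet_Ioo fun κ hκ => mul_nonneg hκ.1.le (kdens_nonneg hL hτ hκ)
  unfold postVar E1mK kExp
  rw [e1, e2]
  set D := ∫ κ in Ioo (0:ℝ) 1, kdens a L x τ κ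
  set A₁ := ∫ κ in Ioo (0:ℝ) 1, κ * kdens a L x τ κ
  set A₂ := ∫ κ in Ioo (0:ℝ) 1, κ^2 * kdens a L x τ κ
  have h1 : (D - A₁) / D = 1 - A₁ / D := by field_simp
  have h2 : (D - 2 * A₁ + A₂) / D = 1 - 2 * (A₁ / D) + A₂ / D := by field_simp
  rw [h1, h2]
  have h3 : 0 ≤ A₁ / D := by positivity
  nlinarith [mul_nonneg (sq_nonneg x) (sq_nonneg (A₁ / D))]

lemma exists_integral_kdens_ge_exp {a c0 t0 : ℝ} {L : ℝ → ℝ} (ha : 1/2 ≤ a)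
    (hLm : Measurable L) (hL : ∀ t, 0 < t → 0 ≤ L t) (hc0 : 0 < c0) (ht0 : 0 < t0)
    (hLc : ∀ t, t0 ≤ t → c0 ≤ L t)
    (hI : IntegrableOn (fun t => t ^ (-a-1) * L t) (Ioi (0:ℝ))) :
    ∃ c : ℝ, 0 < c ∧ ∀ x τ : ℝ, 0 < τ → τ ≤ 1 → 1 ≤ x^2/2 →
      c * (x^2/2) ^ (-(a + 1/2)) * Real.exp (x^2/2) ≤ ∫ κ in Ioo (0:ℝ) 1, kdens a L x τ κ := by
  set k : ℝ := 1 / (1 + t0) with hk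
  have hk0 : 0 < k := by positivity
  have hk1 : k < 1 := by rw [hk, div_lt_one (by positivity)]; linarith
  refine ⟨(k/2) ^ (a + 1/2) * c0 * Real.exp (-1), by positivity, fun x τ hτ hτ1 hy => ?_⟩
  obtain ⟨y, hy'⟩ : ∃ y, y = x^2/2 := ⟨_, rfl⟩
  rw [← hy'] at hy ⊢
  have hy0 : 0 < y := by linarith
  set b := (k/2) * y⁻¹ with hb
  have hb0 : 0 < b := by positivity
  have hky : 2 * b ≤ k := by
    have : y⁻¹ ≤ 1 := inv_le_one_of_one_le₀ hy
    rw [hb]; nlinarith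
  have hby : b * y = k / 2 := by rw [hb]; field_simp
  have hsub : Ioo b (2*b) ⊆ Ioo 0 1 := Ioo_subset_Ioo hb0.le (by linarith)
  have i0 := integrableOn_kdens (x := x) hLm hL hτ hI
  calc (k/2) ^ (a + 1/2) * c0 * Real.exp (-1) * y ^ (-(a + 1/2)) * Real.exp y
      = ∫ κ in Ioo b (2*b), b ^ (a - 1/2) * 1 * c0 * Real.exp (y - 1) := by
        have h1 : b ^ (a + 1/2) = (k/2) ^ (a + 1/2) * y ^ (-(a + 1/2)) := by
          rw [hb, Real.mul_rpow (by positivity) (by positivity), Real.inv_rpow hy0.le,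
            Real.rpow_neg hy0.le]
        have h2 : b ^ (a + 1/2) = b ^ (a - 1/2) * b := by
          nth_rewrite 3 [← Real.rpow_one b]
          rw [← Real.rpow_add hb0]
          congr 1
          ring
        rw [setIntegral_const, measureReal_def, Real.volume_Ioo, ENNReal.toReal_ofReal (by linarith),
          smul_eq_mul, Real.exp_sub, Real.exp_neg]
        have h3 : (2 * b - b) * (b ^ (a - 1/2) * 1 * c0 * (Real.exp y / Real.exp 1)) =
            (b ^ (a - 1/2) * b) * c0 * (Real.exp 1)⁻¹ * Real.exp y := by
          field_simp
          ring
        rw [h3, ← h2, h1]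
        ring
    _ ≤ ∫ κ in Ioo b (2*b), kdens a L x τ κ := by
        refine setIntegral_mono_on (integrable_const _) (i0.mono_set hsub)
          measurableSet_Ioo fun κ hκ => ?_
        have h01 := hsub hκ
        have hw : 0 < 1 - κ := by linarith [h01.2]
        have h1 : b ^ (a - 1/2) ≤ κ ^ (a - 1/2) :=
          Real.rpow_le_rpow hb0.le hκ.1.le (by linarith)
        have h2 : 1 ≤ (1 - κ) ^ (-a - 1) :=
          Real.one_le_rpow_of_pos_of_le_one_of_nonpos hw (by linarith [h01.1]) (by linarith)
        have h3 : c0 ≤ L ((1/τ^2) * (1/κ - 1)) := by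
          apply hLc
          have h4 : 1 + t0 ≤ 1/κ := by
            rw [le_div_iff₀ h01.1]
            have : κ ≤ k := hκ.2.le.trans hky
            rw [hk, le_div_iff₀ (by positivity)] at this
            linarith
          have h5 : 1 ≤ 1/τ^2 := by
            rw [le_div_iff₀ (by positivity)]
            nlinarith
          nlinarith
        have h4 : Real.exp (y - 1) ≤ Real.exp ((1 - κ) * x^2 / 2) := by
          apply Real.exp_le_exp.2
          have e : (1 - κ) * x^2 / 2 = y - κ * y := by rw [hy']; ring
          have : κ * y ≤ 2 * b * y := mul_le_mul_of_nonneg_right hκ.2.le hy0.le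
          rw [e]
          nlinarith
        unfold kdens
        have h5 : 0 ≤ b ^ (a - 1/2) := by positivity
        have h6 : 0 ≤ κ ^ (a - 1/2) := h5.trans h1
        have h7 : 0 ≤ L ((1/τ^2) * (1/κ - 1)) := hc0.le.trans h3
        gcongr
    _ ≤ _ := setIntegral_mono_set i0
        ((ae_restrict_iff' measurableSet_Ioo).2 (ae_of_all _ fun κ hκ => kdens_nonneg hL hτ hκ))
        hsub.eventuallyLE

lemma rpow_le_mul_exp_half {p u : ℝ} (hp : 0 < p) (hu : 0 ≤ u) :
    u ^ p ≤ (2*p) ^ p * Real.exp (u/2) := by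
  have h1 : u ≤ 2 * p * Real.exp (u / (2*p)) := by
    have h := Real.add_one_le_exp (u / (2*p))
    calc u = 2 * p * (u / (2*p)) := by field_simp
      _ ≤ _ := by gcongr; linarith
  calc u ^ p ≤ (2 * p * Real.exp (u / (2*p))) ^ p := Real.rpow_le_rpow hu h1 hp.le
    _ = _ := by
      rw [Real.mul_rpow (by positivity) (by positivity), ← Real.exp_mul]
      congr 2
      field_simp

lemma one_sub_rpow_mul_le {a Mb : ℝ} {L : ℝ → ℝ} (ha : 1/2 ≤ a)
    (hL : ∀ t, 0 < t → 0 ≤ L t) (hLM : ∀ t, 0 < t → L t ≤ Mb) {τ κ : ℝ} (hτ : 0 < τ)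
    (hκ : κ ∈ Ioo (0:ℝ) 1) :
    (1 - κ) ^ (-a - 1) * L ((1/τ^2) * (1/κ - 1)) ≤
      Mb * 2 ^ (a + 1) + 2 ^ a * mixDens a L τ κ := by
  have h0 := hκ.1
  have hw : 0 < 1 - κ := by linarith [hκ.2]
  have hm := mixDens_nonneg (a := a) hL hτ hκ
  have hφ := kappa_pos hτ hκ
  have hLφ := hL _ hφ
  have hM := hLM _ hφ
  have hM0 : 0 ≤ Mb := hLφ.trans hM
  rcases le_total κ (1/2) with h | h
  · have h1 : (1 - κ) ^ (-a - 1) ≤ 2 ^ (a + 1) := by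
      have := Real.rpow_le_rpow_of_nonpos (show (0:ℝ) < 1/2 by norm_num)
        (show 1/2 ≤ 1 - κ by linarith) (show -a - 1 ≤ 0 by linarith)
      refine this.trans_eq ?_
      rw [one_div, Real.inv_rpow (by norm_num), ← Real.rpow_neg (by norm_num)]
      congr 1
      ring
    calc (1 - κ) ^ (-a - 1) * L ((1/τ^2) * (1/κ - 1)) ≤ 2 ^ (a + 1) * Mb := by gcongr
      _ ≤ _ := by
        have : 0 ≤ (2:ℝ) ^ a * mixDens a L τ κ := by positivity
        linarith
  · have h1 : 1 ≤ 2 ^ a * κ ^ (a - 1) := by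
      have h2 : κ ^ a ≤ κ ^ (a - 1) := Real.rpow_le_rpow_of_exponent_ge h0 hκ.2.le (by linarith)
      have h3 : (1/2 : ℝ) ^ a ≤ κ ^ a := Real.rpow_le_rpow (by norm_num) h (by linarith)
      have h4 : (2:ℝ) ^ a * (1/2) ^ a = 1 := by
        rw [← Real.mul_rpow (by norm_num) (by norm_num)]
        norm_num
      calc 1 = (2:ℝ) ^ a * (1/2) ^ a := h4.symm
        _ ≤ _ := by gcongr; exact h3.trans h2
    have h5 : 0 ≤ (1 - κ) ^ (-a - 1) * L ((1/τ^2) * (1/κ - 1)) := by positivity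
    have h6 : 0 ≤ Mb * 2 ^ (a + 1) := by positivity
    unfold mixDens
    nlinarith [mul_le_mul_of_nonneg_right h1 h5]

lemma sq_mul_kdens_le {a A : ℝ} {L : ℝ → ℝ} (ha : 1/2 ≤ a) (hA : 0 ≤ A)
    (hL : ∀ t, 0 < t → 0 ≤ L t) {x τ κ : ℝ} (hτ : 0 < τ)
    (hx : 1 ≤ x^2/2) (hκ : κ ∈ Ioo (0:ℝ) 1) :
    x^2 * (κ^2 * kdens a L x τ κ) ≤ 2 * A * kdens a L x τ κ +
      2 * (2 * (a + 3/2)) ^ (a + 3/2) * Real.exp (-(A/2)) *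
        ((x^2/2) ^ (-(a + 1/2)) * Real.exp (x^2/2)) *
        ((1 - κ) ^ (-a - 1) * L ((1/τ^2) * (1/κ - 1))) := by
  have h0 := hκ.1
  have hw : 0 < 1 - κ := by linarith [hκ.2]
  have hk := kdens_nonneg (a := a) (x := x) hL hτ hκ
  have hLφ := hL _ (kappa_pos hτ hκ)
  obtain ⟨y, hy⟩ : ∃ y, y = x^2/2 := ⟨_, rfl⟩
  have hxy : x^2 = 2*y := by rw [hy]; ring
  rw [← hy] at hx ⊢
  have hy0 : 0 < y := by linarith
  rcases le_total (κ * y) A with h | h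
  · have h1 : x^2 * κ^2 ≤ 2 * A := by
      rw [hxy]
      have := mul_nonneg h0.le hy0.le
      nlinarith [hκ.2]
    have h2 : 0 ≤ 2 * (2 * (a + 3/2)) ^ (a + 3/2) * Real.exp (-(A/2)) *
        (y ^ (-(a + 1/2)) * Real.exp y) *
        ((1 - κ) ^ (-a - 1) * L ((1/τ^2) * (1/κ - 1))) := by
      have : 0 ≤ 2 * (a + 3/2) := by linarith
      positivity
    nlinarith [mul_le_mul_of_nonneg_right h1 hk]
  · have h1 := rpow_le_mul_exp_half (p := a + 3/2) (u := κ * y) (by linarith) (by positivity)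
    have h2 : y * κ^2 * κ ^ (a - 1/2) = y ^ (-(a + 1/2)) * (κ * y) ^ (a + 3/2) := by
      rw [Real.mul_rpow h0.le hy0.le, mul_comm (κ ^ (a + 3/2)), ← mul_assoc,
        ← Real.rpow_add hy0, mul_assoc, ← Real.rpow_natCast κ 2, ← Real.rpow_add h0]
      congr 1
      · rw [show -(a + 1/2) + (a + 3/2) = 1 by ring, Real.rpow_one]
      · congr 1
        push_cast
        ring
    have h3 : Real.exp ((1 - κ) * x^2 / 2) =
        Real.exp y * Real.exp (-(κ * y / 2)) * Real.exp (-(κ * y / 2)) := by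
      rw [← Real.exp_add, ← Real.exp_add, hxy]
      congr 1
      ring
    have h4 : Real.exp (κ * y / 2) * Real.exp (-(κ * y / 2)) = 1 := by
      rw [← Real.exp_add]; simp
    have h5 : Real.exp (-(κ * y / 2)) ≤ Real.exp (-(A/2)) := Real.exp_le_exp.2 (by linarith)
    refine le_trans ?_ (le_add_of_nonneg_left (by positivity))
    have hp : 0 ≤ 2 * (a + 3/2) := by linarith
    calc x^2 * (κ^2 * kdens a L x τ κ)
        = 2 * (y * κ^2 * κ ^ (a - 1/2)) * Real.exp ((1 - κ) * x^2 / 2) *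
          ((1 - κ) ^ (-a - 1) * L ((1/τ^2) * (1/κ - 1))) := by
          unfold kdens
          rw [hxy]
          ring
      _ = 2 * (y ^ (-(a + 1/2)) * (κ * y) ^ (a + 3/2)) *
          (Real.exp y * Real.exp (-(κ * y / 2)) * Real.exp (-(κ * y / 2))) *
          ((1 - κ) ^ (-a - 1) * L ((1/τ^2) * (1/κ - 1))) := by rw [h2, h3]
      _ ≤ 2 * (y ^ (-(a + 1/2)) * ((2 * (a + 3/2)) ^ (a + 3/2) * Real.exp (κ * y / 2))) *
          (Real.exp y * Real.exp (-(κ * y / 2)) * Real.exp (-(A/2))) *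
          ((1 - κ) ^ (-a - 1) * L ((1/τ^2) * (1/κ - 1))) := by gcongr
      _ = 2 * (2 * (a + 3/2)) ^ (a + 3/2) * Real.exp (-(A/2)) * (y ^ (-(a + 1/2)) * Real.exp y) *
          ((1 - κ) ^ (-a - 1) * L ((1/τ^2) * (1/κ - 1))) *
          (Real.exp (κ * y / 2) * Real.exp (-(κ * y / 2))) := by ring
      _ = _ := by rw [h4, mul_one]

lemma exists_postVar_le_log {a Mb c0 t0 : ℝ} {L : ℝ → ℝ} (ha : 1/2 ≤ a)
    (hL : AssumpL L Mb c0 t0)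
    (hI : IntegrableOn (fun t => t ^ (-a-1) * L t) (Ioi (0:ℝ))) :
    ∃ C : ℝ, 0 < C ∧ ∀ x τ : ℝ, 0 < τ → τ ≤ 1 → postVar a L x τ ≤ C * (1 - Real.log τ) := by
  obtain ⟨hLm, hLpos, hLM, hc0, ht0, hLc⟩ := hL
  have hL0 : ∀ t, 0 < t → 0 ≤ L t := fun t ht => (hLpos t ht).le
  have hM0 : 0 < Mb := (hLpos 1 one_pos).trans_le (hLM 1 one_pos)
  obtain ⟨c, hc, hD⟩ := exists_integral_kdens_ge hLm hLpos hI
  obtain ⟨c', hc', hD'⟩ := exists_integral_kdens_ge_exp ha hLm hL0 hc0 ht0 hLc hI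
  set I := ∫ t in Ioi (0:ℝ), t ^ (-a-1) * L t with hIdef
  have hI0 : 0 ≤ I := setIntegral_nonneg measurableSet_Ioi fun t ht =>
    mul_nonneg (Real.rpow_nonneg (le_of_lt ht) _) (hL0 t ht)
  set P : ℝ := 2 * (2 * (a + 3/2)) ^ (a + 3/2) with hP
  have hP0 : 0 ≤ P := by
    have : 0 ≤ 2 * (a + 3/2) := by linarith
    positivity
  set Q : ℝ := Mb * 2 ^ (a + 1) + 2 ^ a * I with hQ
  have hQ0 : 0 ≤ Q := by positivity
  refine ⟨3 + 8 * a + P * Q / c', by positivity, fun x τ hτ hτ1 => ?_⟩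
  have hlog : 0 ≤ -Real.log τ := by linarith [Real.log_nonpos hτ.le hτ1]
  have hτp : 0 < τ ^ (-(2*a)) := Real.rpow_pos_of_pos hτ _
  have hD0 : 0 < ∫ κ in Ioo (0:ℝ) 1, kdens a L x τ κ :=
    (by positivity : (0:ℝ) < c * τ ^ (-(2*a))).trans_le (hD x τ hτ hτ1)
  have i0 := integrableOn_kdens (x := x) hLm hL0 hτ hI
  have i2 : IntegrableOn (fun κ => κ^2 * kdens a L x τ κ) (Ioo 0 1) :=
    integrableOn_bounded_mul_kdens (B := 1) hLm hL0 hτ hI (by fun_prop)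
      (fun κ hκ => abs_le.2 ⟨by nlinarith [hκ.1], by nlinarith [hκ.1, hκ.2]⟩)
  have hR : 0 ≤ P * Q / c' := by positivity
  have key : x^2 * ((∫ κ in Ioo (0:ℝ) 1, κ^2 * kdens a L x τ κ) /
      ∫ κ in Ioo (0:ℝ) 1, kdens a L x τ κ) ≤ 2 + 8 * a * (-Real.log τ) + P * Q / c' := by
    rw [← mul_div_assoc, div_le_iff₀ hD0]
    rcases le_total 1 (x^2/2) with hy | hy
    · set A := 4 * a * (-Real.log τ) with hA
      have hA0 : 0 ≤ A := by positivity
      have hexp : Real.exp (-(A/2)) * τ ^ (-(2*a)) = 1 := by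
        rw [Real.rpow_def_of_pos hτ, ← Real.exp_add, Real.exp_eq_one_iff, hA]
        ring
      have hτ1' : 1 ≤ τ ^ (-(2*a)) :=
        Real.one_le_rpow_of_pos_of_le_one_of_nonpos hτ hτ1 (by linarith)
      set Y := (x^2/2) ^ (-(a + 1/2)) * Real.exp (x^2/2) with hY
      have hY0 : 0 ≤ Y := by positivity
      have hDY : Y ≤ (∫ κ in Ioo (0:ℝ) 1, kdens a L x τ κ) / c' := by
        rw [le_div_iff₀ hc']
        have := hD' x τ hτ hτ1 hy
        rw [hY]
        linarith
      have j1 := i0.const_mul (2 * A)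
      have j3 := (integrableOn_mixDens hτ hI).const_mul (2 ^ a)
      have j4 : IntegrableOn (fun _ : ℝ => Mb * 2 ^ (a + 1)) (Ioo (0:ℝ) 1) :=
        integrable_const _
      have j2 : IntegrableOn (fun κ => P * Real.exp (-(A/2)) * Y *
          (Mb * 2 ^ (a + 1) + 2 ^ a * mixDens a L τ κ)) (Ioo 0 1) :=
        (j4.add j3).const_mul _
      calc x^2 * ∫ κ in Ioo (0:ℝ) 1, κ^2 * kdens a L x τ κ
          = ∫ κ in Ioo (0:ℝ) 1, x^2 * (κ^2 * kdens a L x τ κ) := by rw [integral_const_mul]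
        _ ≤ ∫ κ in Ioo (0:ℝ) 1, (2 * A * kdens a L x τ κ + P * Real.exp (-(A/2)) * Y *
            (Mb * 2 ^ (a + 1) + 2 ^ a * mixDens a L τ κ)) := by
            refine setIntegral_mono_on (i2.const_mul _) (j1.add j2) measurableSet_Ioo
              fun κ hκ => (sq_mul_kdens_le ha hA0 hL0 hτ hy hκ).trans ?_
            gcongr
            exact one_sub_rpow_mul_le ha hL0 hLM hτ hκ
        _ = 2 * A * (∫ κ in Ioo (0:ℝ) 1, kdens a L x τ κ) + P * Real.exp (-(A/2)) * Y *
            (Mb * 2 ^ (a + 1) + 2 ^ a * (τ ^ (-(2*a)) * I)) := by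
            rw [integral_add j1 j2, integral_const_mul, integral_const_mul, integral_add j4 j3,
              integral_const_mul (2 ^ a), integral_mixDens hτ, setIntegral_const]
            simp [← hIdef]
        _ ≤ 2 * A * (∫ κ in Ioo (0:ℝ) 1, kdens a L x τ κ) + P * Real.exp (-(A/2)) * Y *
            (Mb * 2 ^ (a + 1) * τ ^ (-(2*a)) + 2 ^ a * (τ ^ (-(2*a)) * I)) := by
            have : Mb * 2 ^ (a + 1) ≤ Mb * 2 ^ (a + 1) * τ ^ (-(2*a)) :=
              le_mul_of_one_le_right (by positivity) hτ1'
            gcongr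
        _ = 2 * A * (∫ κ in Ioo (0:ℝ) 1, kdens a L x τ κ) +
            P * Q * Y * (Real.exp (-(A/2)) * τ ^ (-(2*a))) := by rw [hQ]; ring
        _ ≤ 2 * A * (∫ κ in Ioo (0:ℝ) 1, kdens a L x τ κ) +
            P * Q * ((∫ κ in Ioo (0:ℝ) 1, kdens a L x τ κ) / c') := by
            rw [hexp, mul_one]
            gcongr
        _ = (8 * a * (-Real.log τ) + P * Q / c') * ∫ κ in Ioo (0:ℝ) 1, kdens a L x τ κ := by
            rw [hA]; ring
        _ ≤ _ := by gcongr; linarith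
    · have h1 : ∫ κ in Ioo (0:ℝ) 1, κ^2 * kdens a L x τ κ ≤
          ∫ κ in Ioo (0:ℝ) 1, kdens a L x τ κ := by
        refine setIntegral_mono_on i2 i0 measurableSet_Ioo fun κ hκ => ?_
        exact mul_le_of_le_one_left (kdens_nonneg hL0 hτ hκ) (pow_le_one₀ hκ.1.le hκ.2.le)
      have h2 : 0 ≤ 8 * a * (-Real.log τ) := by positivity
      calc x^2 * ∫ κ in Ioo (0:ℝ) 1, κ^2 * kdens a L x τ κ
          ≤ 2 * ∫ κ in Ioo (0:ℝ) 1, kdens a L x τ κ := by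
            refine mul_le_mul (by linarith) h1 ?_ (by norm_num)
            exact setIntegral_nonneg measurableSet_Ioo fun κ hκ =>
              mul_nonneg (sq_nonneg κ) (kdens_nonneg hL0 hτ hκ)
        _ ≤ _ := by gcongr; linarith
  have h1 := postVar_le_one_add hLm hL0 hτ hI hD0
  nlinarith [mul_nonneg hR hlog]

lemma gaussian_integral_tail_le {M : ℝ} (hM : 0 ≤ M) :
    ∫ z, (if M < |z| then (1:ℝ) else 0) ∂(gaussianReal 0 1) ≤ 2 * Real.exp (-(M^2/2)) := by
  have hint : ∀ t : ℝ, Integrable (fun z : ℝ => Real.exp (t * z)) (gaussianReal 0 1) :=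
    fun t => integrable_exp_mul_gaussianReal t
  have hmgf : ∀ t : ℝ, ∫ z : ℝ, Real.exp (t * z) ∂(gaussianReal 0 1) = Real.exp (t^2/2) := by
    intro t
    have := mgf_gaussianReal (p := gaussianReal 0 1) (X := fun z => z) (μ := 0) (v := 1)
      (by simp) t
    simpa [mgf] using this
  have hi : Integrable (fun z : ℝ => Real.exp (-M^2) * (Real.exp (M * z) + Real.exp (-M * z)))
      (gaussianReal 0 1) := ((hint M).add (hint (-M))).const_mul _
  calc ∫ z, (if M < |z| then (1:ℝ) else 0) ∂(gaussianReal 0 1)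
      ≤ ∫ z : ℝ, Real.exp (-M^2) * (Real.exp (M * z) + Real.exp (-M * z)) ∂(gaussianReal 0 1) := by
        refine integral_mono_of_nonneg (ae_of_all _ fun z => ?_) hi (ae_of_all _ fun z => ?_)
        · show (0:ℝ) ≤ if M < |z| then (1:ℝ) else 0
          split_ifs <;> norm_num
        · show (if M < |z| then (1:ℝ) else 0) ≤
            Real.exp (-M^2) * (Real.exp (M * z) + Real.exp (-M * z))
          split_ifs with h
          · rw [mul_add, ← Real.exp_add, ← Real.exp_add]
            rcases abs_cases z with ⟨hz, _⟩ | ⟨hz, _⟩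
            · have : 1 ≤ Real.exp (-M^2 + M * z) := Real.one_le_exp (by rw [hz] at h; nlinarith)
              linarith [Real.exp_pos (-M^2 + -M * z)]
            · have : 1 ≤ Real.exp (-M^2 + -M * z) := Real.one_le_exp (by rw [hz] at h; nlinarith)
              linarith [Real.exp_pos (-M^2 + M * z)]
          · positivity
    _ = 2 * Real.exp (-(M^2/2)) := by
        rw [integral_const_mul, integral_add (hint M) (hint (-M)), hmgf, hmgf, neg_sq, ← two_mul,
          mul_left_comm, ← Real.exp_add]
        congr 2
        ring

lemma gaussian_integral_exp_sq_le {M : ℝ} (hM : 0 ≤ M) :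
    ∫ z, (if |z| ≤ M then Real.exp (z^2/2) else 0) ∂(gaussianReal 0 1) ≤ 2 * M := by
  rw [integral_gaussianReal_eq_integral_smul one_ne_zero]
  have e : ∀ z : ℝ, gaussianPDFReal 0 1 z • (if |z| ≤ M then Real.exp (z^2/2) else 0) =
      (Icc (-M) M).indicator (fun _ => (√(2 * π))⁻¹) z := by
    intro z
    by_cases h : |z| ≤ M
    · rw [if_pos h, indicator_of_mem (show z ∈ Icc (-M) M from abs_le.1 h), gaussianPDFReal,
        smul_eq_mul, mul_assoc, ← Real.exp_add]
      simp [neg_div]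
    · rw [if_neg h, smul_zero,
        indicator_of_notMem (show z ∉ Icc (-M) M from fun h' => h (abs_le.2 h'))]
  simp_rw [e]
  rw [integral_indicator measurableSet_Icc, setIntegral_const, measureReal_def, Real.volume_Icc,
    ENNReal.toReal_ofReal (by linarith), smul_eq_mul, sub_neg_eq_add, ← two_mul]
  refine mul_le_of_le_one_right (by positivity) (inv_le_one_of_one_le₀ ?_)
  rw [Real.one_le_sqrt]
  nlinarith [Real.pi_gt_three]

lemma measurable_tail (M : ℝ) : Measurable (fun z : ℝ => if M < |z| then (1:ℝ) else 0) :=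
  Measurable.ite (measurableSet_lt measurable_const measurable_id.abs) measurable_const
    measurable_const

lemma integrable_tail (M : ℝ) (μ : Measure ℝ) [IsFiniteMeasure μ] :
    Integrable (fun z : ℝ => if M < |z| then (1:ℝ) else 0) μ := by
  refine Integrable.of_bound (C := 1) (measurable_tail M).aestronglyMeasurable
    (ae_of_all _ fun z => ?_)
  split_ifs <;> simp

lemma measurable_trunc_exp (M : ℝ) :
    Measurable (fun z : ℝ => if |z| ≤ M then Real.exp (z^2/2) else 0) :=
  Measurable.ite (measurableSet_le measurable_id.abs measurable_const) (by fun_prop)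
    measurable_const

lemma integrable_trunc_exp (M : ℝ) (μ : Measure ℝ) [IsFiniteMeasure μ] :
    Integrable (fun z : ℝ => if |z| ≤ M then Real.exp (z^2/2) else 0) μ := by
  refine Integrable.of_bound (C := Real.exp (M^2/2)) (measurable_trunc_exp M).aestronglyMeasurable
    (ae_of_all _ fun z => ?_)
  split_ifs with h
  · rw [Real.norm_eq_abs, abs_of_pos (Real.exp_pos _)]
    apply Real.exp_le_exp.2
    have : z^2 ≤ M^2 := sq_le_sq' (by linarith [(abs_le.1 h).1]) (abs_le.1 h).2
    linarith
  · simp [Real.exp_nonneg]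

instance (n : ℕ) (θ0 : Fin n → ℝ) : IsProbabilityMeasure (Pmeas n θ0) := by
  unfold Pmeas
  infer_instance

lemma measurePreserving_Pmeas_eval {n : ℕ} (θ0 : Fin n → ℝ) (i : Fin n) :
    MeasurePreserving (fun x : Fin n → ℝ => x i) (Pmeas n θ0) (gaussianReal (θ0 i) 1) :=
  measurePreserving_eval (fun i => gaussianReal (θ0 i) 1) i

lemma integrable_Pmeas_coord {n : ℕ} {θ0 : Fin n → ℝ} {i : Fin n} {f : ℝ → ℝ}
    (hf : Integrable f (gaussianReal (θ0 i) 1)) :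
    Integrable (fun x => f (x i)) (Pmeas n θ0) :=
  (measurePreserving_Pmeas_eval θ0 i).integrable_comp_of_integrable hf

lemma integral_Pmeas_coord {n : ℕ} {θ0 : Fin n → ℝ} {i : Fin n} {f : ℝ → ℝ}
    (hf : Integrable f (gaussianReal (θ0 i) 1)) :
    ∫ x, f (x i) ∂(Pmeas n θ0) = ∫ z, f z ∂(gaussianReal (θ0 i) 1) := by
  have h := measurePreserving_Pmeas_eval θ0 i
  have hf' : AEStronglyMeasurable f ((Pmeas n θ0).map fun x : Fin n → ℝ => x i) := by
    rw [h.map_eq]; exact hf.aestronglyMeasurable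
  rw [← integral_map h.measurable.aemeasurable hf', h.map_eq]

lemma indepFun_Pmeas {n : ℕ} (θ0 : Fin n → ℝ) {i j : Fin n} (hij : i ≠ j) {f g : ℝ → ℝ}
    (hf : Measurable f) (hg : Measurable g) :
    IndepFun (fun x => f (x i)) (fun x => g (x j)) (Pmeas n θ0) := by
  have h := iIndepFun_pi (μ := fun i => gaussianReal (θ0 i) 1) (X := fun _ (z : ℝ) => z)
    (fun i => aemeasurable_id)
  exact (h.indepFun hij).comp hf hg

lemma tauHat_mem {c1 c2 : ℝ} {n : ℕ} (hc2 : 1 ≤ c2) (hn : 1 ≤ n) (x : Fin n → ℝ) :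
    1/(n:ℝ) ≤ tauHat c1 c2 n x ∧ tauHat c1 c2 n x ≤ 1 ∧
      tauHat c1 c2 n x ≤ (1/(n:ℝ)) *
        (1 + ∑ i, if Real.sqrt (c1 * Real.log n) < |x i| then (1:ℝ) else 0) := by
  have hn' : (1:ℝ) ≤ n := by exact_mod_cast hn
  set S := ∑ i, if Real.sqrt (c1 * Real.log n) < |x i| then (1:ℝ) else 0 with hS
  have hS0 : 0 ≤ S := Finset.sum_nonneg fun i _ => by split_ifs <;> norm_num
  have hSn : S ≤ n := by
    calc S ≤ ∑ _i : Fin n, (1:ℝ) := Finset.sum_le_sum fun i _ => by split_ifs <;> norm_num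
      _ = n := by simp
  have h1 : 1/(c2*n) ≤ 1/(n:ℝ) := by
    apply one_div_le_one_div_of_le (by linarith)
    nlinarith
  have h2 : (1/(c2*n)) * S ≤ (1/(n:ℝ)) * S := by gcongr
  refine ⟨le_max_left _ _, max_le ?_ (h2.trans ?_), max_le ?_ (h2.trans ?_)⟩
  · rw [div_le_one (by linarith)]; exact hn'
  · rw [one_div_mul_eq_div, div_le_one (by linarith)]; exact hSn
  · exact le_mul_of_one_le_right (by positivity) (by linarith)
  · gcongr; linarith

lemma sum_ne_zero_le {n q : ℕ} {θ0 : Fin n → ℝ} (hθ : sparse n q θ0) :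
    ∑ j, (if θ0 j ≠ 0 then (1:ℝ) else 0) ≤ q := by
  rw [Finset.sum_boole, ← Fintype.card_subtype, ← Nat.card_eq_fintype_card]
  exact_mod_cast hθ

/-- Expected number of coordinates exceeding the threshold `M`. -/
lemma sum_integral_tail_le {n q : ℕ} {θ0 : Fin n → ℝ} (hθ : sparse n q θ0) {M : ℝ} (hM : 0 ≤ M)
    (hMn : Real.exp (-(M^2/2)) ≤ 1/(n:ℝ)) :
    ∑ j, ∫ z, (if M < |z| then (1:ℝ) else 0) ∂(gaussianReal (θ0 j) 1) ≤ q + 2 := by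
  have hcard := sum_ne_zero_le hθ
  have hnn : (n:ℝ) * (1/n) ≤ 1 := by
    rw [mul_one_div]
    exact div_self_le_one _
  calc ∑ j, ∫ z, (if M < |z| then (1:ℝ) else 0) ∂(gaussianReal (θ0 j) 1)
      ≤ ∑ j, ((if θ0 j ≠ 0 then (1:ℝ) else 0) + 2 * (1/(n:ℝ))) := by
        refine Finset.sum_le_sum fun j _ => ?_
        by_cases h : θ0 j = 0
        · rw [h]
          have := gaussian_integral_tail_le hM
          simp only [ne_eq, not_true_eq_false, if_false]
          linarith
        · rw [if_pos h]
          have : ∫ z, (if M < |z| then (1:ℝ) else 0) ∂(gaussianReal (θ0 j) 1) ≤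
              ∫ _z, (1:ℝ) ∂(gaussianReal (θ0 j) 1) :=
            integral_mono (integrable_tail M _) (integrable_const _) fun z => by
              dsimp only
              split_ifs <;> norm_num
          have h1 : ∫ _z, (1:ℝ) ∂(gaussianReal (θ0 j) 1) = 1 := by simp
          have : 0 ≤ 2 * (1/(n:ℝ)) := by positivity
          linarith
    _ ≤ q + 2 := by
        rw [Finset.sum_add_distrib, Finset.sum_const, Finset.card_univ, Fintype.card_fin,
          nsmul_eq_mul]
        linarith

lemma integral_tail_mul_trunc_exp_le {n : ℕ} (θ0 : Fin n → ℝ) {i : Fin n} (hi : θ0 i = 0)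
    (j : Fin n) {M : ℝ} (hM : 0 ≤ M) :
    Integrable (fun x : Fin n → ℝ => (if M < |x j| then (1:ℝ) else 0) *
      (if |x i| ≤ M then Real.exp ((x i)^2/2) else 0)) (Pmeas n θ0) ∧
    ∫ x : Fin n → ℝ, (if M < |x j| then (1:ℝ) else 0) *
      (if |x i| ≤ M then Real.exp ((x i)^2/2) else 0) ∂(Pmeas n θ0) ≤
    (∫ z, (if M < |z| then (1:ℝ) else 0) ∂(gaussianReal (θ0 j) 1)) * (2 * M) := by
  have hu0 : 0 ≤ ∫ z, (if M < |z| then (1:ℝ) else 0) ∂(gaussianReal (θ0 j) 1) :=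
    integral_nonneg fun z => by
      show (0:ℝ) ≤ if M < |z| then (1:ℝ) else 0
      split_ifs <;> norm_num
  by_cases hij : j = i
  · subst hij
    have e : (fun x : Fin n → ℝ => (if M < |x j| then (1:ℝ) else 0) *
        (if |x j| ≤ M then Real.exp ((x j)^2/2) else 0)) = fun _ => 0 := by
      ext x
      by_cases h : M < |x j|
      · rw [if_neg h.not_ge, mul_zero]
      · rw [if_neg h, zero_mul]
    rw [e]
    refine ⟨integrable_zero _ _ _, ?_⟩
    rw [integral_zero]
    positivity
  · have hu := integrable_tail M (gaussianReal (θ0 j) 1)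
    have hh := integrable_trunc_exp M (gaussianReal (θ0 i) 1)
    have hind := indepFun_Pmeas θ0 hij (measurable_tail M) (measurable_trunc_exp M)
    have iu := integrable_Pmeas_coord hu
    have ih := integrable_Pmeas_coord hh
    refine ⟨hind.integrable_mul iu ih, ?_⟩
    have e := hind.integral_fun_mul_eq_mul_integral iu.aestronglyMeasurable ih.aestronglyMeasurable
    refine (show _ = _ from e).trans_le ?_
    have e1 := integral_Pmeas_coord hu
    have e2 := integral_Pmeas_coord hh
    have e3 := gaussian_integral_exp_sq_le hM
    rw [hi] at e2
    refine mul_le_mul (show _ ≤ _ from e1.le) (show _ ≤ _ from e2.le.trans e3) ?_ hu0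
    exact integral_nonneg fun x => by
      show (0:ℝ) ≤ if |x i| ≤ M then Real.exp ((x i)^2/2) else 0
      split_ifs <;> positivity

/-- A posterior variance bounded by `B` everywhere and by `C * τ * exp (x ^ 2 / 2)` has, at a null
coordinate and at the estimated global parameter, a small integrable majorant. -/
lemma exists_majorant_of_eq_zero {V : ℝ → ℝ → ℝ} {B C c1 c2 : ℝ} (hB : 0 ≤ B) (hC : 0 ≤ C)
    (hc2 : 1 ≤ c2) {n q : ℕ} (hn : 1 ≤ n)
    (hV1 : ∀ x τ, 1/(n:ℝ) ≤ τ → τ ≤ 1 → V x τ ≤ B)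
    (hV2 : ∀ x τ, 0 < τ → τ ≤ 1 → V x τ ≤ C * τ * Real.exp (x^2/2))
    {θ0 : Fin n → ℝ} (hθ : sparse n q θ0)
    (hMn : Real.exp (-((√(c1 * Real.log n))^2/2)) ≤ 1/(n:ℝ)) {i : Fin n} (hi : θ0 i = 0) :
    ∃ g : (Fin n → ℝ) → ℝ, Integrable g (Pmeas n θ0) ∧
      (∀ x, V (x i) (tauHat c1 c2 n x) ≤ g x) ∧
      ∫ x, g x ∂(Pmeas n θ0) ≤ (2 * B + 2 * C * √(c1 * Real.log n) * (q + 3)) / n := by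
  have hn0 : (0:ℝ) < n := by exact_mod_cast hn
  set M := √(c1 * Real.log n) with hM
  have hM0 : 0 ≤ M := Real.sqrt_nonneg _
  have iu := integrable_Pmeas_coord (i := i) (integrable_tail M (gaussianReal (θ0 i) 1))
  have ih := integrable_Pmeas_coord (i := i) (integrable_trunc_exp M (gaussianReal (θ0 i) 1))
  have iuh := fun j => (integral_tail_mul_trunc_exp_le θ0 hi j hM0).1
  have eu := integral_Pmeas_coord (i := i) (integrable_tail M (gaussianReal (θ0 i) 1))
  have eh := integral_Pmeas_coord (i := i) (integrable_trunc_exp M (gaussianReal (θ0 i) 1))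
  have isum := integrable_finsetSum Finset.univ fun j _ => iuh j
  refine ⟨fun x => B * (if M < |x i| then (1:ℝ) else 0) + C / n *
    ((if |x i| ≤ M then Real.exp ((x i)^2/2) else 0) +
      ∑ j, (if M < |x j| then (1:ℝ) else 0) * (if |x i| ≤ M then Real.exp ((x i)^2/2) else 0)),
    (iu.const_mul B).add ((ih.add isum).const_mul _), fun x => ?_, ?_⟩
  · obtain ⟨t1, t2, t3⟩ := tauHat_mem (c1 := c1) hc2 hn x
    rw [← hM] at t3
    have t0 : 0 < tauHat c1 c2 n x := lt_of_lt_of_le (by positivity) t1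
    by_cases h : M < |x i|
    · have := hV1 (x i) _ t1 t2
      simpa [h, h.not_ge] using this
    · have h' : |x i| ≤ M := not_lt.1 h
      refine (hV2 (x i) _ t0 t2).trans ?_
      beta_reduce
      rw [if_neg h, if_pos h', ← Finset.sum_mul, mul_zero, zero_add]
      calc C * tauHat c1 c2 n x * Real.exp ((x i)^2/2)
          ≤ C * ((1/(n:ℝ)) * (1 + ∑ j, if M < |x j| then (1:ℝ) else 0)) *
            Real.exp ((x i)^2/2) := by gcongr
        _ = _ := by ring
  · have b1 : ∫ x : Fin n → ℝ, (if M < |x i| then (1:ℝ) else 0) ∂(Pmeas n θ0) ≤ 2 * (1/(n:ℝ)) := by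
      refine (show _ = _ from eu).trans_le ?_
      rw [hi]
      exact (gaussian_integral_tail_le hM0).trans (by gcongr)
    have b2 : ∫ x : Fin n → ℝ, (if |x i| ≤ M then Real.exp ((x i)^2/2) else 0) ∂(Pmeas n θ0) ≤
        2 * M := by
      refine (show _ = _ from eh).trans_le ?_
      rw [hi]
      exact gaussian_integral_exp_sq_le hM0
    have b3 : ∫ x : Fin n → ℝ, ∑ j, (if M < |x j| then (1:ℝ) else 0) *
        (if |x i| ≤ M then Real.exp ((x i)^2/2) else 0) ∂(Pmeas n θ0) ≤ (q + 2) * (2 * M) := by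
      rw [integral_finsetSum _ fun j _ => iuh j]
      refine (Finset.sum_le_sum fun j _ => (integral_tail_mul_trunc_exp_le θ0 hi j hM0).2).trans ?_
      rw [← Finset.sum_mul]
      exact mul_le_mul_of_nonneg_right (sum_integral_tail_le hθ hM0 hMn) (by positivity)
    have e := integral_add (iu.const_mul B) ((ih.add isum).const_mul (C / n))
    have e' := integral_add ih isum
    rw [integral_const_mul, integral_const_mul] at e
    refine (show _ = _ from e).trans_le ?_
    have e'' : ∀ s : ℝ, s ≤ 2 * M + (q + 2) * (2 * M) → C / n * s ≤
        C / n * (2 * M + (q + 2) * (2 * M)) := fun s hs => by gcongr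
    calc _ ≤ B * (2 * (1/(n:ℝ))) + C / n * (2 * M + (q + 2) * (2 * M)) := by
          refine add_le_add (mul_le_mul_of_nonneg_left b1 hB) (e'' _ ?_)
          exact (show _ = _ from e').trans_le (add_le_add b2 b3)
      _ = _ := by ring

end PaperGL

open PaperGL MeasureTheory ProbabilityTheory Real Filter Set in
/-- Theorem 1: the total empirical Bayes posterior variance is `≲ qₙ log n`. -/
theorem stmt3 (a : ℝ) (ha : 1/2 ≤ a) (L : ℝ → ℝ) (Mb c0 t0 K : ℝ)
    (hL : AssumpL L Mb c0 t0) (hK : Kcond a L K)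
    (β : ℝ) (hβ : 0 < β ∧ β < 1) (q : ℕ → ℕ) (hq : propTo q β)
    (c1 c2 : ℝ) (hc1 : 2 ≤ c1) (hc2 : 1 ≤ c2) :
    ∃ C : ℝ, 0 < C ∧ ∀ᶠ n : ℕ in atTop, ∀ θ0 : Fin n → ℝ, sparse n (q n) θ0 →
      (∫ x, (∑ i, postVar a L (x i) (tauHat c1 c2 n x)) ∂(Pmeas n θ0))
        ≤ C * (q n : ℝ) * Real.log n := by
  obtain ⟨C1, hC1, hV1⟩ := exists_postVar_le_log ha hL hK.1
  obtain ⟨C2, hC2, hV2⟩ := exists_postVar_le_mul_exp ha hL.1 hL.2.1 hL.2.2.1 hK.1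
  refine ⟨6 * C1 + 8 * C2 * c1, by positivity, ?_⟩
  obtain ⟨k1, k2, hk1, hk2, hev⟩ := hq
  filter_upwards [hev, eventually_ge_atTop 3] with n hqn hn3 θ0 hθ
  have hn3' : (3:ℝ) ≤ n := by exact_mod_cast hn3
  have hn0 : (0:ℝ) < n := by linarith
  have hq1 : (1:ℝ) ≤ q n := by
    have : (0:ℝ) < q n := lt_of_lt_of_le (by positivity) hqn.1
    exact_mod_cast (Nat.cast_pos.1 this)
  have hlog : 1 ≤ Real.log n := by
    rw [Real.le_log_iff_exp_le hn0]
    linarith [Real.exp_one_lt_d9]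
  have hM2 : (√(c1 * Real.log n))^2 = c1 * Real.log n := Real.sq_sqrt (by positivity)
  have hM1 : √(c1 * Real.log n) ≤ c1 * Real.log n := by
    rw [Real.sqrt_le_left (by positivity)]
    have : 1 ≤ c1 * Real.log n := by nlinarith
    nlinarith
  have hMn : Real.exp (-((√(c1 * Real.log n))^2/2)) ≤ 1/(n:ℝ) := by
    rw [hM2, one_div, ← Real.exp_log (inv_pos.2 hn0), Real.log_inv]
    apply Real.exp_le_exp.2
    nlinarith
  set B := 2 * C1 * Real.log n with hB
  have hB0 : 0 ≤ B := by positivity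
  have hVB : ∀ x τ, 1/(n:ℝ) ≤ τ → τ ≤ 1 → postVar a L x τ ≤ B := by
    intro x τ h1 h2
    have hτ : 0 < τ := lt_of_lt_of_le (by positivity) h1
    have h3 : -Real.log n ≤ Real.log τ := by
      rw [← Real.log_inv, ← one_div]
      exact Real.log_le_log (by positivity) h1
    calc postVar a L x τ ≤ C1 * (1 - Real.log τ) := hV1 x τ hτ h2
      _ ≤ C1 * (2 * Real.log n) := by gcongr; linarith
      _ = B := by ring
  set R := (2 * B + 2 * C2 * √(c1 * Real.log n) * (q n + 3)) / n with hR
  have hR0 : 0 ≤ R := by positivity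
  have hg : ∀ i, ∃ g : (Fin n → ℝ) → ℝ, Integrable g (Pmeas n θ0) ∧
      (∀ x, postVar a L (x i) (tauHat c1 c2 n x) ≤ g x) ∧
      ∫ x, g x ∂(Pmeas n θ0) ≤ R + B * (if θ0 i ≠ 0 then (1:ℝ) else 0) := by
    intro i
    by_cases hi : θ0 i = 0
    · obtain ⟨g, hg1, hg2, hg3⟩ := exists_majorant_of_eq_zero (V := postVar a L) hB0 hC2.le hc2
        (by omega) hVB hV2 hθ hMn hi
      exact ⟨g, hg1, hg2, by simpa [hi] using hg3⟩
    · refine ⟨fun _ => B, integrable_const _, fun x => ?_, ?_⟩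
      · obtain ⟨t1, t2, -⟩ := tauHat_mem (c1 := c1) hc2 (by omega : 1 ≤ n) x
        exact hVB _ _ t1 t2
      · simpa [hi] using hR0
  choose g hg1 hg2 hg3 using hg
  have hsum : ∑ i, ∫ x, g i x ∂(Pmeas n θ0) ≤ (6 * C1 + 8 * C2 * c1) * (q n : ℝ) * Real.log n := by
    calc ∑ i, ∫ x, g i x ∂(Pmeas n θ0)
        ≤ ∑ i, (R + B * (if θ0 i ≠ 0 then (1:ℝ) else 0)) := Finset.sum_le_sum fun i _ => hg3 i
      _ = n * R + B * ∑ i, (if θ0 i ≠ 0 then (1:ℝ) else 0) := by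
          rw [Finset.sum_add_distrib, ← Finset.mul_sum]
          simp
      _ ≤ n * R + B * q n := by gcongr; exact sum_ne_zero_le hθ
      _ = 2 * B + 2 * C2 * √(c1 * Real.log n) * (q n + 3) + B * q n := by
          rw [hR, mul_div_cancel₀ _ hn0.ne']
      _ ≤ 2 * B * q n + 2 * C2 * (c1 * Real.log n) * (q n + 3 * q n) + B * q n := by
          have : 2 * B ≤ 2 * B * q n := le_mul_of_one_le_right (by positivity) hq1
          gcongr
          linarith
      _ = _ := by rw [hB]; ring
  by_cases hint : Integrable (fun x => ∑ i, postVar a L (x i) (tauHat c1 c2 n x)) (Pmeas n θ0)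
  · refine le_trans ?_ hsum
    rw [← integral_finsetSum _ fun i _ => hg1 i]
    exact integral_mono hint (integrable_finsetSum _ fun i _ => hg1 i) fun x =>
      Finset.sum_le_sum fun i _ => hg2 i x
  · rw [integral_undef hint]
    positivity
end
end

section
/- Fix constants c1 ≥ 2, c2 ≥ 1 and γ > 1 with c2γ − 1 > 1. Then there exists a constant C > 0 such that for all sufficiently large n, sup_{θ0 ∈ ℓ0[q_n]} P_{θ0}( (1/(c2 n)) Σ_{j=1}^n 1{|X_j| > √(c1 log n)} > γ q_n / n ) ≤ C q_n / n; in particular P_{θ0}(τ̂ > γ q_n/n) ≤ C q_n/n. -/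
open MeasureTheory ProbabilityTheory Real Filter Set

noncomputable section

namespace PaperGL

lemma gaussianReal_lt_abs_le {t : ℝ} (ht : 0 ≤ t) :
    (gaussianReal 0 1).real {x | t < |x|} ≤ 2 * Real.exp (-t ^ 2 / 2) := by
  have hu : (gaussianReal 0 1).real {x | t ≤ x} ≤ Real.exp (-t ^ 2 / 2) := by
    have h := measure_ge_le_exp_mul_mgf (μ := gaussianReal 0 1) (X := id) t ht
      (by simpa using integrable_exp_mul_gaussianReal t)
    rw [mgf_id_gaussianReal, ← Real.exp_add] at h
    refine h.trans (le_of_eq ?_)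
    congr 1
    push_cast
    ring
  have hl : (gaussianReal 0 1).real {x | x ≤ -t} ≤ Real.exp (-t ^ 2 / 2) := by
    have h := measure_le_le_exp_mul_mgf (μ := gaussianReal 0 1) (X := id) (t := -t) (-t)
      (by linarith) (by simpa using integrable_exp_mul_gaussianReal (-t))
    rw [mgf_id_gaussianReal, ← Real.exp_add] at h
    refine h.trans (le_of_eq ?_)
    congr 1
    push_cast
    ring
  calc (gaussianReal 0 1).real {x | t < |x|}
      ≤ (gaussianReal 0 1).real ({x | t ≤ x} ∪ {x | x ≤ -t}) := by
        refine measureReal_mono fun x hx => ?_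
        rcases lt_abs.1 (show t < |x| from hx) with h | h
        · exact Or.inl h.le
        · exact Or.inr (show x ≤ -t by linarith)
    _ ≤ _ := (measureReal_union_le _ _).trans (by linarith)

/-- Chernoff bound for the number of coordinates of a product measure that fall into rare sets. -/
lemma pi_sum_indicator_ge_le {ι : Type*} [Fintype ι] {E : ι → Type*}
    [∀ i, MeasurableSpace (E i)] (μ : ∀ i, Measure (E i)) [∀ i, IsProbabilityMeasure (μ i)]
    (S : ∀ i, Set (E i)) (hS : ∀ i, MeasurableSet (S i)) {p : ℝ}
    (hp : ∀ i, (μ i).real (S i) ≤ p) (a : ℝ) :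
    (Measure.pi μ).real {x | a ≤ ∑ i, (S i).indicator (fun _ => (1 : ℝ)) (x i)} ≤
      Real.exp (2 * (Fintype.card ι * p) - a) := by
  have hexp : ∀ i x, Real.exp ((S i).indicator (fun _ => (1 : ℝ)) x) =
      1 + (S i).indicator (fun _ => Real.exp 1 - 1) x := by
    intro i x
    by_cases hx : x ∈ S i <;> simp [hx]
  have hint : ∀ i, Integrable (fun x => Real.exp ((S i).indicator (fun _ => (1 : ℝ)) x)) (μ i) := by
    intro i
    simp_rw [hexp]
    exact (integrable_const _).add ((integrable_const _).indicator (hS i))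
  have hone : ∀ i, ∫ x, Real.exp ((S i).indicator (fun _ => (1 : ℝ)) x) ∂μ i ≤
      Real.exp (2 * p) := by
    intro i
    simp_rw [hexp]
    rw [integral_add (integrable_const _) ((integrable_const _).indicator (hS i)),
      integral_indicator_const _ (hS i)]
    have h1 := Real.add_one_le_exp (2 * p)
    have h2 := Real.exp_one_lt_d9
    have h3 := hp i
    have h4 : 0 ≤ (μ i).real (S i) := measureReal_nonneg
    simp only [integral_const, probReal_univ, smul_eq_mul]
    nlinarith
  have hI : Integrable (fun x : ∀ i, E i =>
      Real.exp (1 * ∑ i, (S i).indicator (fun _ => (1 : ℝ)) (x i))) (Measure.pi μ) := by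
    simp_rw [one_mul, Real.exp_sum]
    exact Integrable.fintype_prod_dep hint
  refine (measure_ge_le_exp_mul_mgf a zero_le_one hI).trans ?_
  rw [mgf]
  simp_rw [one_mul, Real.exp_sum]
  rw [integral_fintype_prod_eq_prod
    (f := fun i x => Real.exp ((S i).indicator (fun _ => (1 : ℝ)) x))]
  calc _ ≤ Real.exp (-1 * a) * ∏ _i : ι, Real.exp (2 * p) := by
        refine mul_le_mul_of_nonneg_left (Finset.prod_le_prod ?_ fun i _ => hone i)
          (Real.exp_pos _).le
        exact fun i _ => integral_nonneg_of_ae (ae_of_all _ fun x => (Real.exp_pos _).le)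
    _ = _ := by
        rw [Finset.prod_const, Finset.card_univ, ← Real.exp_nat_mul, ← Real.exp_add]
        congr 1
        ring

/-- Exceedances over a threshold by a `q`-sparse Gaussian vector: more than `a + q` of them force
more than `a` null exceedances. -/
lemma Pmeas_exceedances_le {n q : ℕ} {θ : Fin n → ℝ} (hθ : sparse n q θ) {t : ℝ} (ht : 0 ≤ t)
    (a : ℝ) :
    (Pmeas n θ).real {x | a + q < ∑ j, if t < |x j| then (1 : ℝ) else 0} ≤
      Real.exp (4 * (n * Real.exp (-t ^ 2 / 2)) - a) := by
  classical
  let S : Fin n → Set ℝ := fun i => if θ i = 0 then {x | t < |x|} else ∅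
  have hS : ∀ i, MeasurableSet (S i) := by
    intro i
    by_cases h : θ i = 0
    · simp only [S, h, if_true]
      exact measurableSet_lt measurable_const measurable_id.abs
    · simp [S, h]
  have hp : ∀ i, (gaussianReal (θ i) 1).real (S i) ≤ 2 * Real.exp (-t ^ 2 / 2) := by
    intro i
    by_cases h : θ i = 0
    · simpa only [S, h, if_true] using gaussianReal_lt_abs_le ht
    · simpa [S, h] using (Real.exp_pos _).le
  have key := pi_sum_indicator_ge_le (fun i => gaussianReal (θ i) 1) S hS hp a
  have hcount : ∑ i, (if θ i ≠ 0 then (1 : ℝ) else 0) ≤ q := by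
    rw [Finset.sum_boole, ← Fintype.card_subtype, ← Nat.card_eq_fintype_card]
    exact_mod_cast hθ
  rw [Pmeas]
  refine (measureReal_mono fun x hx => ?_).trans (key.trans (le_of_eq ?_))
  · have hle : ∑ j, (if t < |x j| then (1 : ℝ) else 0) ≤
        ∑ j, (S j).indicator (fun _ => (1 : ℝ)) (x j) +
          ∑ j, (if θ j ≠ 0 then (1 : ℝ) else 0) := by
      rw [← Finset.sum_add_distrib]
      refine Finset.sum_le_sum fun j _ => ?_
      by_cases h : θ j = 0
      · simp [S, h, Set.indicator_apply]
      · simp only [S, h, if_false, Set.indicator_empty]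
        split_ifs <;> simp_all
    have hx' : a + q < ∑ j, if t < |x j| then (1 : ℝ) else 0 := hx
    change a ≤ ∑ j, (S j).indicator (fun _ => (1 : ℝ)) (x j)
    linarith
  · rw [Fintype.card_fin]
    congr 1
    ring

/-- A sequence of polynomial growth eventually exceeds the logarithm. -/
lemma propTo.eventually_log_le {q : ℕ → ℕ} {β : ℝ} (hβ : 0 < β) (hq : propTo q β) :
    ∀ᶠ n : ℕ in atTop, Real.log n ≤ q n := by
  obtain ⟨k1, k2, hk1, -, h⟩ := hq
  have hlog := ((isLittleO_log_rpow_atTop hβ).comp_tendsto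
    (tendsto_natCast_atTop_atTop (R := ℝ))).bound hk1
  filter_upwards [h, hlog] with n hn hl
  refine le_trans ?_ hn.1
  simp only [Function.comp_apply, Real.norm_eq_abs] at hl
  rw [abs_of_nonneg (Real.rpow_nonneg n.cast_nonneg β)] at hl
  exact (le_abs_self _).trans hl

end PaperGL
open PaperGL MeasureTheory ProbabilityTheory Real Filter Set in
/-- tail probability bound for the empirical Bayes estimate of `τ`. -/
theorem stmt5 (β : ℝ) (hβ : 0 < β ∧ β < 1) (q : ℕ → ℕ) (hq : propTo q β)
    (c1 c2 γ : ℝ) (hc1 : 2 ≤ c1) (hc2 : 1 ≤ c2) (hγ : 1 < γ) (hγ2 : 1 < c2 * γ - 1) :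
    ∃ C : ℝ, 0 < C ∧ ∀ᶠ n : ℕ in atTop, ∀ θ0 : Fin n → ℝ, sparse n (q n) θ0 →
      ((Pmeas n θ0)
          {x | γ * (q n : ℝ) / (n:ℝ) <
            (1/(c2*(n:ℝ))) * ∑ j, if Real.sqrt (c1 * Real.log n) < |x j| then (1:ℝ) else 0}).toReal
        ≤ C * (q n : ℝ) / (n:ℝ) ∧
      ((Pmeas n θ0) {x | γ * (q n : ℝ) / (n:ℝ) < tauHat c1 c2 n x}).toReal
        ≤ C * (q n : ℝ) / (n:ℝ) := by
  refine ⟨Real.exp 4, Real.exp_pos 4, ?_⟩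
  filter_upwards [hq.eventually_log_le hβ.1, eventually_ge_atTop 2] with n hlog hn θ0 hθ
  have hn1 : (1 : ℝ) < n := by exact_mod_cast hn
  have hn0 : (0 : ℝ) < n := by linarith
  have hlogpos : 0 < Real.log n := Real.log_pos hn1
  have hq1 : (1 : ℝ) ≤ q n := by
    have h : (0 : ℝ) < q n := hlogpos.trans_le hlog
    exact_mod_cast h
  have hnp : (n : ℝ) * Real.exp (-(√(c1 * Real.log n)) ^ 2 / 2) ≤ 1 := by
    rw [Real.sq_sqrt (by positivity)]
    calc (n : ℝ) * Real.exp (-(c1 * Real.log n) / 2)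
        ≤ n * Real.exp (-Real.log n) := by
          gcongr
          nlinarith
      _ = 1 := by rw [Real.exp_neg, Real.exp_log hn0, mul_inv_cancel₀ hn0.ne']
  have hbound : Real.exp (4 * (n * Real.exp (-(√(c1 * Real.log n)) ^ 2 / 2)) - q n) ≤
      Real.exp 4 * q n / n := by
    calc _ ≤ Real.exp (4 + -Real.log n) := Real.exp_le_exp.2 (by linarith)
      _ = Real.exp 4 * 1 / n := by
          rw [Real.exp_add, Real.exp_neg, Real.exp_log hn0, mul_one, div_eq_mul_inv]
      _ ≤ _ := by gcongr
  have hmain : ((Pmeas n θ0) {x | γ * (q n : ℝ) / (n:ℝ) < (1/(c2*(n:ℝ))) *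
      ∑ j, if Real.sqrt (c1 * Real.log n) < |x j| then (1:ℝ) else 0}).toReal ≤
        Real.exp 4 * (q n : ℝ) / (n:ℝ) := by
    refine le_trans ?_ ((Pmeas_exceedances_le hθ (Real.sqrt_nonneg _) (q n)).trans hbound)
    have : IsProbabilityMeasure (Pmeas n θ0) := by
      unfold Pmeas
      infer_instance
    refine measureReal_mono fun x hx => ?_
    simp only [Set.mem_ofPred_eq] at hx ⊢
    rw [one_div_mul_eq_div, div_lt_div_iff₀ hn0 (by positivity)] at hx
    have hx' : c2 * γ * q n < ∑ j, if Real.sqrt (c1 * Real.log n) < |x j| then (1:ℝ) else 0 := by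
      refine lt_of_mul_lt_mul_right ?_ hn0.le
      linarith
    nlinarith
  refine ⟨hmain, ?_⟩
  have hset : {x | γ * (q n : ℝ) / (n:ℝ) < tauHat c1 c2 n x} =
      {x | γ * (q n : ℝ) / (n:ℝ) < (1/(c2*(n:ℝ))) *
        ∑ j, if Real.sqrt (c1 * Real.log n) < |x j| then (1:ℝ) else 0} := by
    ext x
    have h1 : ¬ γ * (q n : ℝ) / n < 1 / n := by
      rw [not_lt]
      gcongr
      nlinarith
    simp only [Set.mem_ofPred_eq, tauHat, lt_max_iff, h1, false_or]
  rw [hset]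
  exact hmain
end
end
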